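/- arXiv:2605.00995 — 2 statements merged into one kernel-verified Lean document; each statement's English description precedes it below -/
import Mathlib

section
/- There exist absolute constants c > 0 and C > 0 such that the following holds. For all positive integers m, n and all integers r with 1 ≤ r ≤ c·√(log₂ n), and all functions P₁,…,Pₙ : 𝔽₂^m → 𝔽₂ with rank₁(P_i) ≤ r for all i ∈ [n], ‖(P₁,…,Pₙ) − Ber(1/3)^⊗n‖_TV ≥ 1 − C·2^{r/2}/n^{1/(r+1)}. -/
open Finset

/-- Distribution of `f(X)` on `β` for `X` uniform on the finite type `α`. -/
noncomputable def distOf {α β : Type*} [Fintype α] [DecidableEq β] (f : α → β) (y : β) : ℝ :=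
  ((Finset.univ.filter fun x => f x = y).card : ℝ) / (Fintype.card α : ℝ)

/-- Output distribution on `𝔽₂ⁿ` of the tuple `(P₁(X),…,Pₙ(X))` for uniform `X ∈ 𝔽₂^m`. -/
noncomputable def outDist {m n : ℕ} (P : Fin n → (Fin m → ZMod 2) → ZMod 2) :
    (Fin n → ZMod 2) → ℝ :=
  distOf (fun x i => P i x)

/-- Total variation distance between two distributions on a finite type. -/
noncomputable def tvDist {β : Type*} [Fintype β] (μ ν : β → ℝ) : ℝ :=
  (1 / 2) * ∑ y, |μ y - ν y|

/-- The distribution `Ber(1/3)^{⊗n}` on `𝔽₂ⁿ`. -/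
noncomputable def ber13 {n : ℕ} (y : Fin n → ZMod 2) : ℝ :=
  (1 / 3 : ℝ) ^ (Finset.univ.filter fun i => y i = 1).card *
    (2 / 3 : ℝ) ^ (n - (Finset.univ.filter fun i => y i = 1).card)

/-- `P : 𝔽₂^m → 𝔽₂` has degree at most `d`. -/
def DegLE {m : ℕ} (d : ℕ) (P : (Fin m → ZMod 2) → ZMod 2) : Prop :=
  ∃ p : MvPolynomial (Fin m) (ZMod 2), p.totalDegree ≤ d ∧ ∀ x, MvPolynomial.eval x p = P x

/-- `rank_{d'}(P) ≤ k`. -/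
def RankLE {m : ℕ} (d' k : ℕ) (P : (Fin m → ZMod 2) → ZMod 2) : Prop :=
  ∃ (Q : Fin k → (Fin m → ZMod 2) → ZMod 2) (Γ : (Fin k → ZMod 2) → ZMod 2),
    (∀ j, DegLE d' (Q j)) ∧ ∀ x, P x = Γ (fun j => Q j x)

/-- `Pr_{X uniform}[P(X) = 1]`. -/
noncomputable def prOne {m : ℕ} (P : (Fin m → ZMod 2) → ZMod 2) : ℝ :=
  distOf P 1


section helpers

lemma one_var (p ε : ℝ) (he : 0 < ε) (he1 : ε ≤ 1/3)
    (h : ε ≤ |p - 1/3|) :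
    ∃ g : ZMod 2 → ℝ, (∀ z, 0 < g z) ∧ p * g 1 + (1 - p) * g 0 ≤ 1 - ε^2/20 ∧
      (1/3) * (g 1)⁻¹ + (2/3) * (g 0)⁻¹ ≤ 1 - ε^2/20 := by
  obtain ⟨a, b, ha, hb, h1, h2⟩ : ∃ a b : ℝ, 0 < a ∧ 0 < b ∧
      p * a + (1 - p) * b ≤ 1 - ε^2/20 ∧ (1/3) * a⁻¹ + (2/3) * b⁻¹ ≤ 1 - ε^2/20 := by
    have key : ∀ θ : ℝ, |θ| = ε / 4 → (p - 1/3) * θ ≥ ε * (ε/4) → ∃ a b : ℝ, 0 < a ∧ 0 < b ∧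
      p * a + (1 - p) * b ≤ 1 - ε^2/20 ∧ (1/3) * a⁻¹ + (2/3) * b⁻¹ ≤ 1 - ε^2/20 := by
      intro θ hθ hp
      have hle := abs_le.1 hθ.le
      have hsq : θ^2 = ε^2/16 := by rw [← sq_abs, hθ]; ring
      have hε2 : ε^2 ≤ 1/9 := by nlinarith
      have e0 : 0 < ε^2 := by positivity
      have ha : 0 < 1 - 2*θ := by linarith
      have hb : 0 < 1 + θ := by linarith
      refine ⟨(1 - 2*θ) * (1 + ε^2/4), (1 + θ) * (1 + ε^2/4), by positivity, by positivity, ?_, ?_⟩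
      · have : p * ((1 - 2*θ) * (1 + ε^2/4)) + (1 - p) * ((1 + θ) * (1 + ε^2/4))
          = (1 - 3 * ((p-1/3)*θ)) * (1 + ε^2/4) := by ring
        rw [this]
        have : (1 - 3 * ((p-1/3)*θ)) * (1 + ε^2/4) ≤ (1 - 3 * (ε * (ε/4))) * (1 + ε^2/4) := by
          gcongr
        nlinarith
      · rw [mul_inv, mul_inv]
        have : (1/3) * ((1 - 2*θ)⁻¹ * (1 + ε^2/4)⁻¹) + (2/3) * ((1 + θ)⁻¹ * (1 + ε^2/4)⁻¹)
          = (1 - θ) / ((1 - θ - 2 * θ^2) * (1 + ε^2/4)) := by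
          have : 1 - θ - 2 * θ^2 = (1 - 2*θ) * (1 + θ) := by ring
          rw [this]
          field_simp
          ring
        rw [this, hsq]
        rw [div_le_iff₀ (by apply mul_pos <;> nlinarith)]
        have h3 : θ ≤ 1/12 := by linarith
        have h4 : -(1/12) ≤ θ := by linarith
        generalize ε^2 = q at *
        have : (1 - q/20) * (1 + q/4) ≥ 1 + q * (7/36) := by nlinarith
        have h5 : 1 - θ - 2*(q/16) ≥ 0 := by linarith
        have : (1 - θ - 2*(q/16)) * ((1 - q/20) * (1 + q/4)) ≥ (1 - θ - 2*(q/16)) * (1 + q * (7/36)) := by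
          gcongr
        nlinarith
    rcases le_abs.1 h with h | h
    · exact key (ε/4) (abs_of_pos (by linarith)) (by nlinarith)
    · exact key (-(ε/4)) (by rw [abs_neg, abs_of_pos (by linarith)]) (by nlinarith)
  refine ⟨fun z => if z = 1 then a else b, fun z => by dsimp only; split_ifs <;> assumption, ?_, ?_⟩
  · simpa using h1
  · simpa using h2

lemma ber13_eq {n : ℕ} (y : Fin n → ZMod 2) :
    ber13 y = ∏ i, (if y i = 1 then (1/3 : ℝ) else 2/3) := by
  unfold ber13
  rw [Finset.prod_ite]
  simp only [Finset.prod_const]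
  congr 2
  have := Finset.card_filter_add_card_filter_not (s := (univ : Finset (Fin n))) (fun i => y i = 1)
  simp only [Finset.card_univ, Fintype.card_fin] at this
  omega

lemma sum_prod_fun {n : ℕ} (f : Fin n → ZMod 2 → ℝ) :
    ∑ y : Fin n → ZMod 2, ∏ i, f i (y i) = ∏ i, (f i 0 + f i 1) := by
  have := Finset.prod_univ_sum (fun _ : Fin n => (univ : Finset (ZMod 2))) f
  rw [Fintype.piFinset_univ] at this
  rw [← this]
  refine Finset.prod_congr rfl fun i _ => ?_
  exact Fin.sum_univ_two (f i)

lemma ber13_sum {n : ℕ} : ∑ y : Fin n → ZMod 2, ber13 y = 1 := by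
  simp_rw [ber13_eq]
  rw [sum_prod_fun (fun _ z => if z = 1 then (1/3 : ℝ) else 2/3)]
  norm_num

lemma outDist_sum {m n : ℕ} (P : Fin n → (Fin m → ZMod 2) → ZMod 2) :
    ∑ y, outDist P y = 1 := by
  unfold outDist distOf
  rw [← Finset.sum_div, ← Nat.cast_sum, ← Finset.card_eq_sum_card_fiberwise]
  · rw [Finset.card_univ, div_self]
    positivity
  · intro x _; simp

lemma tv_ge {m n : ℕ} (P : Fin n → (Fin m → ZMod 2) → ZMod 2) :
    tvDist (outDist P) ber13 = 1 - ∑ y, min (outDist P y) (ber13 y) := by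
  unfold tvDist
  have : ∀ y, |outDist P y - ber13 y| = outDist P y + ber13 y - 2 * min (outDist P y) (ber13 y) := by
    intro y
    rcases le_total (outDist P y) (ber13 y) with h | h
    · rw [min_eq_left h, abs_of_nonpos (by linarith)]; ring
    · rw [min_eq_right h, abs_of_nonneg (by linarith)]; ring
  simp_rw [this]
  rw [Finset.sum_sub_distrib, Finset.sum_add_distrib, outDist_sum, ber13_sum, ← Finset.mul_sum]
  ring

/-- independence -/
def Ind {m n : ℕ} (P : Fin n → (Fin m → ZMod 2) → ZMod 2)
    (W : Submodule (ZMod 2) (Fin m → ZMod 2)) [Fintype W] (I : Finset (Fin n)) : Prop :=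
  ∀ (g : Fin n → ZMod 2 → ℝ) (x : Fin m → ZMod 2),
    (∑ w : W, ∏ i ∈ I, g i (P i (x + w))) / (Fintype.card W : ℝ) =
      ∏ i ∈ I, ((∑ w : W, g i (P i (x + w))) / (Fintype.card W : ℝ))

lemma indep_step {V : Type*} [AddCommGroup V] [Module (ZMod 2) V] [Fintype V]
    (W A K : Submodule (ZMod 2) V) [Fintype W] (hAW : A ≤ W) (h : W ≤ A ⊔ K) (F G : V → ℝ)
    (hF : ∀ x, ∀ a ∈ A, F (x + a) = F x) (hG : ∀ x, ∀ a ∈ K, G (x + a) = G x) (x : V) :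
    (∑ w : W, F (x + w) * G (x + w)) / (Fintype.card W : ℝ) =
      ((∑ w : W, F (x + w)) / (Fintype.card W : ℝ)) * ((∑ w : W, G (x + w)) / (Fintype.card W : ℝ)) := by
  classical
  have : Fintype A := Fintype.ofFinite _
  have shift : ∀ (f : V → ℝ) (a : V), a ∈ W → ∑ w : W, f (x + w + a) = ∑ w : W, f (x + w) := by
    intro f a ha
    refine Fintype.sum_equiv (Equiv.addRight (⟨a, ha⟩ : W)) _ _ ?_
    intro w; simp [add_assoc]
  set H : V → ℝ := fun v => ∑ a : A, G (v + a) with hH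
  have HA : ∀ v, ∀ b ∈ A, H (v + b) = H v := by
    intro v b hb
    refine Fintype.sum_equiv (Equiv.addLeft (⟨b, hb⟩ : A)) _ _ ?_
    intro w; simp [add_assoc]
  have HK : ∀ v, ∀ b ∈ K, H (v + b) = H v := by
    intro v b hb
    refine Finset.sum_congr rfl fun a _ => ?_
    rw [add_right_comm, hG _ b hb]
  have Hc : ∀ w : W, H (x + w) = H x := by
    intro w
    obtain ⟨a, ha, k, hk, hw⟩ := Submodule.mem_sup.1 (h w.2)
    rw [← hw, ← add_assoc, HK _ k hk, HA _ a ha]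
  have cA : (0:ℝ) < Fintype.card A := by exact_mod_cast Fintype.card_pos
  have cW : (0:ℝ) < Fintype.card W := by exact_mod_cast Fintype.card_pos
  have e1 : (Fintype.card A : ℝ) * ∑ w : W, G (x + w) = Fintype.card W * H x := by
    calc _ = ∑ a : A, ∑ w : W, G (x + w + a) := by
            rw [Finset.sum_congr rfl fun (a : A) _ => shift G a (hAW a.2)]; simp
      _ = ∑ w : W, H (x + w) := Finset.sum_comm
      _ = _ := by simp [Hc]
  have e2 : (Fintype.card A : ℝ) * ∑ w : W, F (x + w) * G (x + w) = (∑ w : W, F (x + w)) * H x := by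
    calc _ = ∑ a : A, ∑ w : W, F (x + w + a) * G (x + w + a) := by
            rw [Finset.sum_congr rfl fun (a : A) _ => shift (fun v => F v * G v) a (hAW a.2)]; simp
      _ = ∑ a : A, ∑ w : W, F (x + w) * G (x + w + a) := by
            refine Finset.sum_congr rfl fun a _ => Finset.sum_congr rfl fun w _ => ?_
            rw [hF _ a a.2]
      _ = ∑ w : W, F (x + w) * H (x + w) := by
            rw [Finset.sum_comm]; simp [hH, Finset.mul_sum]
      _ = _ := by simp [Hc, Finset.sum_mul]
  have e3 : (∑ w : W, G (x + w)) = Fintype.card W * H x / Fintype.card A := by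
    rw [eq_div_iff cA.ne', mul_comm]; exact e1
  have e4 : ∑ w : W, F (x + w) * G (x + w) = (∑ w : W, F (x + w)) * H x / Fintype.card A := by
    rw [eq_div_iff cA.ne', mul_comm]; exact e2
  rw [e3, e4]
  field_simp

lemma Ind_insert {m n : ℕ} (P : Fin n → (Fin m → ZMod 2) → ZMod 2)
    (K : Fin n → Submodule (ZMod 2) (Fin m → ZMod 2))
    (hK : ∀ i x, ∀ a ∈ K i, P i (x + a) = P i x)
    (W : Submodule (ZMod 2) (Fin m → ZMod 2)) [Fintype W] (I : Finset (Fin n)) (hI : Ind P W I)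
    (i : Fin n) (hi : i ∉ I) (h : W ≤ (W ⊓ ⨅ j ∈ I, K j) ⊔ K i) : Ind P W (insert i I) := by
  intro g x
  simp_rw [Finset.prod_insert hi]
  rw [← hI g x, mul_comm]
  rw [← indep_step W (W ⊓ ⨅ j ∈ I, K j) (K i) inf_le_left h
    (fun v => ∏ j ∈ I, g j (P j v)) (fun v => g i (P i v)) ?_ ?_ x]
  · simp_rw [mul_comm]
  · intro x a ha
    refine Finset.prod_congr rfl fun j hj => ?_
    rw [hK]
    have := (Submodule.mem_inf.1 ha).2
    simp only [Submodule.mem_iInf] at this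
    exact this j hj
  · intro x a ha
    simp only [hK i x a ha]

lemma affine_of_deg {m : ℕ} (Q : (Fin m → ZMod 2) → ZMod 2) (h : DegLE 1 Q) :
    ∃ L : (Fin m → ZMod 2) →ₗ[ZMod 2] ZMod 2, ∀ x, Q x = L x + Q 0 := by
  obtain ⟨p, hp, hQ⟩ := h
  have key : ∀ x y, Q (x + y) + Q 0 = Q x + Q y := by
    intro x y
    simp_rw [← hQ, MvPolynomial.eval_eq, ← Finset.sum_add_distrib]
    refine Finset.sum_congr rfl fun d hd => ?_
    have hd1 : (d.sum fun _ e => e) ≤ 1 := (MvPolynomial.le_totalDegree hd).trans hp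
    have hdeg : d.degree ≤ 1 := hd1
    rcases Nat.le_one_iff_eq_zero_or_eq_one.1 hdeg with h0 | h1
    · rw [Finsupp.degree_eq_zero_iff] at h0
      subst h0; simp
    · obtain ⟨i, rfl⟩ := (Finsupp.sum_eq_one_iff d).1 h1
      rw [Finsupp.support_single _ one_ne_zero]
      simp [mul_add]
  refine ⟨AddMonoidHom.toZModLinearMap 2
    { toFun := fun x => Q x - Q 0, map_zero' := by simp, map_add' := ?_ }, ?_⟩
  · intro x y; linear_combination key x y
  · intro x; simp

lemma exists_K {m r : ℕ} (P : (Fin m → ZMod 2) → ZMod 2) (h : RankLE 1 r P) :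
    ∃ K : Submodule (ZMod 2) (Fin m → ZMod 2), (∀ x, ∀ a ∈ K, P (x + a) = P x) ∧
      m ≤ Module.finrank (ZMod 2) K + r := by
  obtain ⟨Q, Γ, hQ, hP⟩ := h
  choose L hL using fun j => affine_of_deg (Q j) (hQ j)
  refine ⟨LinearMap.ker (LinearMap.pi L), ?_, ?_⟩
  · intro x a ha
    rw [hP, hP]
    congr 1
    funext j
    rw [hL j (x + a), hL j x, map_add]
    have : L j a = 0 := congrFun (LinearMap.mem_ker.1 ha) j
    rw [this, add_zero]
  · have h1 := LinearMap.finrank_range_add_finrank_ker (LinearMap.pi L)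
    have h2 := Submodule.finrank_le (LinearMap.range (LinearMap.pi L))
    simp only [Module.finrank_fin_fun] at h1 h2
    omega

end helpers

section helpers2

lemma gap {m r : ℕ} (P : (Fin m → ZMod 2) → ZMod 2)
    (K W : Submodule (ZMod 2) (Fin m → ZMod 2)) [Fintype W]
    (hK : ∀ x, ∀ a ∈ K, P (x + a) = P x) (hr : m ≤ Module.finrank (ZMod 2) K + r)
    (x : Fin m → ZMod 2) :
    (1/3) * (1/2:ℝ)^r ≤
      |((univ.filter fun w : W => P (x + w) = 1).card : ℝ) / (Fintype.card W : ℝ) - 1/3| := by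
  classical
  set H : Submodule (ZMod 2) W := K.comap W.subtype with hH
  have hfr : Module.finrank (ZMod 2) W ≤ Module.finrank (ZMod 2) H + r := by
    have h1 := LinearMap.finrank_range_add_finrank_ker (K.mkQ.comp W.subtype)
    rw [LinearMap.ker_comp, Submodule.ker_mkQ, ← hH] at h1
    have h2 := Submodule.finrank_le (LinearMap.range (K.mkQ.comp W.subtype))
    have h3 := Submodule.finrank_quotient_add_finrank K
    simp only [Module.finrank_fin_fun] at h3
    omega
  have hle : Module.finrank (ZMod 2) H ≤ Module.finrank (ZMod 2) W := Submodule.finrank_le H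
  have : Fintype H := Fintype.ofFinite _
  have cW : Fintype.card W = 2 ^ Module.finrank (ZMod 2) W := by
    have := Module.card_eq_pow_finrank (K := ZMod 2) (V := W)
    simpa using this
  have cH : Fintype.card H = 2 ^ Module.finrank (ZMod 2) H := by
    have := Module.card_eq_pow_finrank (K := ZMod 2) (V := H)
    simpa using this
  obtain ⟨d, hd⟩ := Nat.exists_eq_add_of_le hle
  have hdr : d ≤ r := by omega
  set S := univ.filter fun w : W => P (x + w) = 1 with hS
  have hdiv : Fintype.card H ∣ S.card := by
    rw [Finset.card_eq_sum_card_image (fun w : W => H.mkQ w) S]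
    refine Finset.dvd_sum fun b hb => ?_
    obtain ⟨s, hs, rfl⟩ := Finset.mem_image.1 hb
    have : (S.filter fun a => H.mkQ a = H.mkQ s) = univ.image (fun h : H => s + (h : W)) := by
      ext a
      simp only [Finset.mem_filter, Finset.mem_image, Finset.mem_univ, true_and]
      constructor
      · rintro ⟨_, ha⟩
        refine ⟨⟨a - s, ?_⟩, by simp⟩
        rw [Submodule.mkQ_apply, Submodule.mkQ_apply, Submodule.Quotient.eq] at ha
        exact ha
      · rintro ⟨h, rfl⟩
        have hs' : P (x + s) = 1 := by simpa [hS] using hs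
        refine ⟨?_, ?_⟩
        · simp only [hS, Finset.mem_filter, Finset.mem_univ, true_and, Submodule.coe_add]
          rw [← add_assoc, hK _ _ (show ((h : W) : Fin m → ZMod 2) ∈ K from h.2), hs']
        · rw [Submodule.mkQ_apply, Submodule.mkQ_apply, Submodule.Quotient.eq]
          simp
    rw [this, Finset.card_image_of_injective, Finset.card_univ]
    intro a b hab
    exact Subtype.ext (add_left_cancel hab)
  obtain ⟨a, ha⟩ := hdiv
  rw [ha, cW, hd, pow_add, cH]
  push_cast
  have hpos : (0:ℝ) < 2 ^ Module.finrank (ZMod 2) H := by positivity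
  have e : ((2:ℝ) ^ Module.finrank (ZMod 2) H * a) / (2 ^ Module.finrank (ZMod 2) H * 2 ^ d) - 1/3
      = (1/3) * (1/2:ℝ)^d * (3 * a - 2 ^ d) := by
    rw [one_div_pow]
    field_simp
  rw [e, abs_mul, abs_of_pos (by positivity)]
  have hint : (1:ℝ) ≤ |3 * (a:ℝ) - 2 ^ d| := by
    have : (1:ℤ) ≤ |3 * (a:ℤ) - 2 ^ d| := by
      apply Int.one_le_abs
      intro h0
      have h1 : 3 * a = 2 ^ d := by zify; linarith
      have h2 : 3 ∣ 2 ^ d := ⟨a, h1.symm⟩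
      have := Nat.prime_three.dvd_of_dvd_pow h2
      omega
    exact_mod_cast this
  have hp : (1/2:ℝ)^r ≤ (1/2:ℝ)^d := pow_le_pow_of_le_one (by norm_num) (by norm_num) hdr
  have hp0 : (0:ℝ) < (1/2:ℝ)^d := by positivity
  nlinarith

lemma sum_shift {m : ℕ} (W : Submodule (ZMod 2) (Fin m → ZMod 2)) [Fintype W]
    (f : (Fin m → ZMod 2) → ℝ) :
    ∑ x, f x = ∑ x, (∑ w : W, f (x + w)) / (Fintype.card W : ℝ) := by
  have cW : (0:ℝ) < Fintype.card W := by exact_mod_cast Fintype.card_pos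
  rw [← Finset.sum_div, Finset.sum_comm]
  have : ∀ w : W, ∑ x, f (x + w) = ∑ x, f x := fun w =>
    Fintype.sum_equiv (Equiv.addRight (w : Fin m → ZMod 2)) _ _ (fun x => by simp)
  simp [this]

lemma min_bound {m n : ℕ} (P : Fin n → (Fin m → ZMod 2) → ZMod 2)
    (W : Submodule (ZMod 2) (Fin m → ZMod 2)) [Fintype W] (I : Finset (Fin n)) (hI : Ind P W I)
    (ε : ℝ) (he : 0 < ε) (he1 : ε ≤ 1/3)
    (hg : ∀ i ∈ I, ∀ x, ε ≤
      |((univ.filter fun w : W => P i (x + w) = 1).card : ℝ) / (Fintype.card W : ℝ) - 1/3|) :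
    ∑ y, min (outDist P y) (ber13 y) ≤
      (1 + (Fintype.card (Fin m → ZMod 2) : ℝ) / (Fintype.card W : ℝ)) * (1 - ε^2/20) ^ I.card := by
  classical
  have cW : (0:ℝ) < Fintype.card W := by exact_mod_cast Fintype.card_pos
  have cV : (0:ℝ) < Fintype.card (Fin m → ZMod 2) := by exact_mod_cast Fintype.card_pos
  have hη : 0 ≤ 1 - ε^2/20 := by nlinarith
  have hex : ∀ p : ℝ, ∃ g : ZMod 2 → ℝ, ε ≤ |p - 1/3| → ((∀ z, 0 < g z) ∧
      p * g 1 + (1 - p) * g 0 ≤ 1 - ε^2/20 ∧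
      (1/3) * (g 1)⁻¹ + (2/3) * (g 0)⁻¹ ≤ 1 - ε^2/20) := by
    intro p
    by_cases h : ε ≤ |p - 1/3|
    · obtain ⟨g, hg⟩ := one_var p ε he he1 h
      exact ⟨g, fun _ => hg⟩
    · exact ⟨0, fun h' => absurd h' h⟩
  choose G hG using hex
  set q : Fin n → (Fin m → ZMod 2) → ℝ := fun i x =>
    ((univ.filter fun w : W => P i (x + w) = 1).card : ℝ) / (Fintype.card W : ℝ) with hq
  have hqinv : ∀ i x (w : W), q i (x + w) = q i x := by
    intro i x w
    simp only [hq]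
    congr 2
    refine Finset.card_equiv (Equiv.addLeft w) ?_
    intro v
    simp [add_assoc]
  set g : (Fin m → ZMod 2) → (Fin n → ZMod 2) → ℝ := fun x y => ∏ i ∈ I, G (q i x) (y i) with hgdef
  have hgpos : ∀ x y, 0 < g x y := fun x y =>
    Finset.prod_pos fun i hi => (hG (q i x) (hg i hi x)).1 _
  have hginv : ∀ x y (w : W), g (x + w) y = g x y := by
    intro x y w
    simp only [hgdef, hqinv]
  have hber : ∀ y : Fin n → ZMod 2, 0 ≤ ber13 y := fun y => by unfold ber13; positivity
  have hout : ∀ y, outDist P y = ∑ x, (if (fun i => P i x) = y then (1:ℝ) else 0)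
      / Fintype.card (Fin m → ZMod 2) := by
    intro y
    rw [← Finset.sum_div]
    simp [outDist, distOf]
  have hpt : ∀ y, min (outDist P y) (ber13 y) ≤
      (∑ x, (if (fun i => P i x) = y then (1:ℝ) else 0) / Fintype.card (Fin m → ZMod 2) * g x y)
      + ∑ x, (ber13 y * (g x y)⁻¹) / Fintype.card W := by
    intro y
    have n1 : 0 ≤ ∑ x, (if (fun i => P i x) = y then (1:ℝ) else 0)
        / Fintype.card (Fin m → ZMod 2) * g x y :=
      Finset.sum_nonneg fun x _ => mul_nonneg (by split_ifs <;> positivity) (hgpos x y).le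
    have n2' : ∀ x, 0 ≤ (ber13 y * (g x y)⁻¹) / Fintype.card W := fun x =>
      div_nonneg (mul_nonneg (hber y) (inv_nonneg.2 (hgpos x y).le)) cW.le
    have n2 : 0 ≤ ∑ x, (ber13 y * (g x y)⁻¹) / Fintype.card W :=
      Finset.sum_nonneg fun x _ => n2' x
    by_cases hall : ∀ x, 1 ≤ g x y
    · refine (min_le_left _ _).trans ?_
      rw [hout]
      refine le_trans (Finset.sum_le_sum fun x _ => ?_) (le_add_of_nonneg_right n2)
      exact le_mul_of_one_le_right (by split_ifs <;> positivity) (hall x)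
    · push Not at hall
      obtain ⟨x0, hx0⟩ := hall
      refine (min_le_right _ _).trans (le_trans ?_ (le_add_of_nonneg_left n1))
      have hinj : Function.Injective (fun w : W => x0 + (w : Fin m → ZMod 2)) := fun a b hab =>
        Subtype.ext (add_left_cancel hab)
      calc ber13 y ≤ ber13 y * (g x0 y)⁻¹ :=
            le_mul_of_one_le_right (hber y) ((one_le_inv₀ (hgpos _ _)).2 hx0.le)
        _ = ∑ w : W, (ber13 y * (g (x0 + w) y)⁻¹) / Fintype.card W := by
            simp only [hginv]
            rw [Finset.sum_const, Finset.card_univ, nsmul_eq_mul]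
            field_simp
        _ = ∑ x ∈ univ.image (fun w : W => x0 + (w : Fin m → ZMod 2)),
              (ber13 y * (g x y)⁻¹) / Fintype.card W := by
            rw [Finset.sum_image (fun a _ b _ h => hinj h)]
        _ ≤ _ := Finset.sum_le_sum_of_subset_of_nonneg (Finset.subset_univ _) fun x _ _ => n2' x
  refine (Finset.sum_le_sum fun y _ => hpt y).trans ?_
  rw [Finset.sum_add_distrib, add_mul, one_mul]
  refine add_le_add ?_ ?_
  · rw [Finset.sum_comm]
    have e1 : ∀ x, ∑ y, (if (fun i => P i x) = y then (1:ℝ) else 0)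
        / Fintype.card (Fin m → ZMod 2) * g x y
        = g x (fun i => P i x) / Fintype.card (Fin m → ZMod 2) := by
      intro x
      rw [Finset.sum_eq_single (fun i => P i x)]
      · simp; ring
      · intro b _ hb; rw [if_neg (Ne.symm hb)]; simp
      · simp
    simp_rw [e1]
    rw [← Finset.sum_div, sum_shift W, div_le_iff₀ cV]
    have : ∀ x, (∑ w : W, g (x + w) (fun i => P i (x + w))) / (Fintype.card W : ℝ)
        ≤ (1 - ε^2/20) ^ I.card := by
      intro x
      simp only [hginv]
      simp only [hgdef]
      rw [hI (fun i => G (q i x)) x]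
      rw [← Finset.prod_const]
      refine Finset.prod_le_prod (fun i hi => ?_) (fun i hi => ?_)
      · exact div_nonneg (Finset.sum_nonneg fun w _ => ((hG (q i x) (hg i hi x)).1 _).le) cW.le
      · refine le_trans (le_of_eq ?_) (hG (q i x) (hg i hi x)).2.1
        have e2 : ∀ w : W, G (q i x) (P i (x + w)) =
            (if P i (x + w) = 1 then (1:ℝ) else 0) * (G (q i x) 1 - G (q i x) 0) + G (q i x) 0 := by
          intro w
          have : P i (x + w) = 0 ∨ P i (x + w) = 1 := by
            generalize P i (x + w) = z; revert z; decide
          rcases this with h | h <;> simp [h]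
        rw [Finset.sum_congr rfl fun w _ => e2 w, Finset.sum_add_distrib, ← Finset.sum_mul]
        have e3 : (∑ w : W, (if P i (x + w) = 1 then (1:ℝ) else 0)) = q i x * Fintype.card W := by
          simp only [hq]
          rw [div_mul_cancel₀ _ cW.ne']
          simp
        rw [e3]
        simp only [Finset.sum_const, Finset.card_univ, nsmul_eq_mul]
        field_simp
        ring
    refine (Finset.sum_le_sum fun x _ => this x).trans (le_of_eq ?_)
    simp [mul_comm]
  · rw [Finset.sum_comm]
    have : ∀ x, ∑ y, ber13 y * (g x y)⁻¹ / Fintype.card W ≤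
        (1 - ε^2/20) ^ I.card / Fintype.card W := by
      intro x
      rw [← Finset.sum_div]
      gcongr
      have e1 : ∀ y : Fin n → ZMod 2, ber13 y * (g x y)⁻¹ = ∏ i, ((if y i = 1 then (1/3 : ℝ) else 2/3)
          * (if i ∈ I then (G (q i x) (y i))⁻¹ else 1)) := by
        intro y
        rw [ber13_eq, Finset.prod_mul_distrib]
        simp [hgdef]
      simp_rw [e1]
      rw [sum_prod_fun (fun i z => ((if z = 1 then (1/3 : ℝ) else 2/3)
          * (if i ∈ I then (G (q i x) z)⁻¹ else 1)))]
      have e2 : ∏ i, (if i ∈ I then (1 - ε^2/20) else (1:ℝ)) = (1 - ε^2/20) ^ I.card := by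
        simp
      rw [← e2]
      refine Finset.prod_le_prod (fun i _ => ?_) (fun i _ => ?_)
      · split_ifs with h1 h2 h3
        all_goals first
          | (have p0 := (hG (q i x) (hg i ‹_› x)).1 0
             have p1 := (hG (q i x) (hg i ‹_› x)).1 1
             positivity)
          | norm_num
      · by_cases hi : i ∈ I
        · have := (hG (q i x) (hg i hi x)).2.2
          simp only [hi, if_true]
          simp
          simp at this
          linarith
        · simp [hi]; norm_num
    refine (Finset.sum_le_sum fun x _ => this x).trans (le_of_eq ?_)
    rw [Finset.sum_const, Finset.card_univ, nsmul_eq_mul]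
    ring

end helpers2

section helpers3

lemma finrank_iInf {m n r : ℕ} (K : Fin n → Submodule (ZMod 2) (Fin m → ZMod 2))
    (hr : ∀ i, m ≤ Module.finrank (ZMod 2) (K i) + r)
    (W : Submodule (ZMod 2) (Fin m → ZMod 2)) (I : Finset (Fin n)) :
    Module.finrank (ZMod 2) W ≤
      Module.finrank (ZMod 2) (W ⊓ ⨅ j ∈ I, K j : Submodule (ZMod 2) (Fin m → ZMod 2))
        + r * I.card := by
  classical
  induction I using Finset.induction_on with
  | empty =>
    have e : W ⊓ ⨅ j ∈ (∅ : Finset (Fin n)), K j = W := by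
      apply inf_eq_left.2
      exact le_iInf₂ fun j hj => absurd hj (Finset.notMem_empty j)
    rw [e]
    omega
  | insert i I hi ih =>
    rw [Finset.iInf_insert, Finset.card_insert_of_notMem hi]
    have e : W ⊓ (K i ⊓ ⨅ j ∈ I, K j) = (W ⊓ ⨅ j ∈ I, K j) ⊓ K i := by
      rw [inf_comm (K i), inf_assoc]
    rw [e]
    have h1 := Submodule.finrank_sup_add_finrank_inf_eq (W ⊓ ⨅ j ∈ I, K j) (K i)
    have h2 := Submodule.finrank_le ((W ⊓ ⨅ j ∈ I, K j) ⊔ K i)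
    rw [Module.finrank_fin_fun] at h2
    have h3 := hr i
    rw [Nat.mul_succ]
    omega

lemma finrank_drop {m : ℕ} (W A K : Submodule (ZMod 2) (Fin m → ZMod 2)) (hA : A ≤ W)
    (h : ¬ W ≤ A ⊔ K) (s : ℕ)
    (hs : Module.finrank (ZMod 2) W ≤
      Module.finrank (ZMod 2) (W ⊓ K : Submodule (ZMod 2) (Fin m → ZMod 2)) + (s + 1)) :
    Module.finrank (ZMod 2) A ≤
      Module.finrank (ZMod 2) (A ⊓ K : Submodule (ZMod 2) (Fin m → ZMod 2)) + s := by
  have h1 := Submodule.finrank_sup_add_finrank_inf_eq A (W ⊓ K)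
  have e : A ⊓ (W ⊓ K) = A ⊓ K := by rw [← inf_assoc, inf_eq_left.2 hA]
  rw [e] at h1
  have hlt : A ⊔ (W ⊓ K) < W := by
    refine lt_of_le_of_ne (sup_le hA inf_le_left) ?_
    intro he
    apply h
    calc W = A ⊔ (W ⊓ K) := he.symm
      _ ≤ A ⊔ K := sup_le_sup_left inf_le_right _
  have h2 := Submodule.finrank_lt_finrank_of_lt hlt
  omega

lemma main_ind {m n r M T : ℕ} (P : Fin n → (Fin m → ZMod 2) → ZMod 2)
    (K : Fin n → Submodule (ZMod 2) (Fin m → ZMod 2))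
    (hK : ∀ i x, ∀ a ∈ K i, P i (x + a) = P i x)
    (hr : ∀ i, m ≤ Module.finrank (ZMod 2) (K i) + r)
    (hM : (1 - ((1/3) * (1/2:ℝ)^r)^2/20) ^ M ≤ 1/2) (s : ℕ) :
    ∀ (W : Submodule (ZMod 2) (Fin m → ZMod 2)) (D : ℕ),
    (∀ i, Module.finrank (ZMod 2) W ≤
      Module.finrank (ZMod 2) (W ⊓ K i : Submodule (ZMod 2) (Fin m → ZMod 2)) + s) →
    m ≤ Module.finrank (ZMod 2) W + D → M * (1 + r * M) ^ s * (D + T) ≤ n →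
    ∑ y, min (outDist P y) (ber13 y) ≤ 2 * (1/2:ℝ)^T := by
  classical
  have hp1 : (1/2:ℝ)^r ≤ 1 := pow_le_one₀ (by norm_num) (by norm_num)
  have hp0 : 0 < (1/2:ℝ)^r := by positivity
  have finish : ∀ (W : Submodule (ZMod 2) (Fin m → ZMod 2)) [Fintype W] (D : ℕ) (I : Finset (Fin n)),
      m ≤ Module.finrank (ZMod 2) W + D → Ind P W I → M * (D + T) ≤ I.card →
      ∑ y, min (outDist P y) (ber13 y) ≤ 2 * (1/2:ℝ)^T := by
    intro W _ D I hD hI hc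
    refine (min_bound P W I hI ((1/3) * (1/2:ℝ)^r) (by positivity) (by linarith)
      (fun i _ x => gap (P i) (K i) W (hK i) (hr i) x)).trans ?_
    have cW : Fintype.card W = 2 ^ Module.finrank (ZMod 2) W := by
      have := Module.card_eq_pow_finrank (K := ZMod 2) (V := W)
      simpa using this
    have cV : Fintype.card (Fin m → ZMod 2) = 2 ^ m := by simp
    have h0 : 0 ≤ 1 - ((1/3) * (1/2:ℝ)^r)^2/20 := by nlinarith
    have h1 : 1 - ((1/3) * (1/2:ℝ)^r)^2/20 ≤ 1 := by
      have : 0 ≤ ((1/3) * (1/2:ℝ)^r)^2/20 := by positivity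
      linarith
    have a1 : (1 - ((1/3) * (1/2:ℝ)^r)^2/20) ^ I.card ≤ (1/2:ℝ)^(D+T) := by
      calc _ ≤ (1 - ((1/3) * (1/2:ℝ)^r)^2/20) ^ (M * (D + T)) := pow_le_pow_of_le_one h0 h1 hc
        _ = ((1 - ((1/3) * (1/2:ℝ)^r)^2/20) ^ M) ^ (D + T) := pow_mul _ _ _
        _ ≤ _ := pow_le_pow_left₀ (pow_nonneg h0 _) hM _
    have a2 : (Fintype.card (Fin m → ZMod 2) : ℝ) / (Fintype.card W : ℝ) ≤ 2 ^ D := by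
      rw [cW, cV]
      push_cast
      rw [div_le_iff₀ (by positivity), ← pow_add]
      exact pow_le_pow_right₀ (by norm_num) (by omega)
    have a3 : (1:ℝ) ≤ 2 ^ D := one_le_pow₀ (by norm_num)
    calc _ ≤ (2 * 2 ^ D) * (1/2:ℝ)^(D+T) := by
          refine mul_le_mul (by linarith) a1 (pow_nonneg h0 _) (by positivity)
      _ = 2 * ((2 * (1/2:ℝ)) ^ D * (1/2:ℝ)^T) := by rw [mul_pow, pow_add]; ring
      _ = _ := by norm_num
  have hmax : ∀ (W : Submodule (ZMod 2) (Fin m → ZMod 2)) [Fintype W], ∃ I : Finset (Fin n),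
      Ind P W I ∧ ∀ i, i ∉ I → ¬ W ≤ (W ⊓ ⨅ j ∈ I, K j) ⊔ K i := by
    intro W _
    have hne : (univ.filter fun I : Finset (Fin n) => Ind P W I).Nonempty := by
      refine ⟨∅, ?_⟩
      simp only [Finset.mem_filter, Finset.mem_univ, true_and]
      intro g x
      simp
    obtain ⟨I, hI, hm⟩ := Finset.exists_max_image _ Finset.card hne
    simp only [Finset.mem_filter, Finset.mem_univ, true_and] at hI hm
    refine ⟨I, hI, fun i hi hle => ?_⟩
    have := hm _ (Ind_insert P K hK W I hI i hi hle)
    rw [Finset.card_insert_of_notMem hi] at this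
    omega
  induction s with
  | zero =>
    intro W D h1 h2 h3
    have : Fintype W := Fintype.ofFinite _
    obtain ⟨I, hI, hm⟩ := hmax W
    have hu : I = univ := by
      refine Finset.eq_univ_of_forall fun i => ?_
      by_contra hi
      apply hm i hi
      have : W ⊓ K i = W := Submodule.eq_of_le_of_finrank_le inf_le_left (h1 i)
      exact (inf_eq_left.1 this).trans le_sup_right
    refine finish W D I h2 hI ?_
    rw [hu]
    simpa using h3
  | succ s ih =>
    intro W D h1 h2 h3
    have : Fintype W := Fintype.ofFinite _
    obtain ⟨I, hI, hm⟩ := hmax W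
    by_cases hc : M * (D + T) ≤ I.card
    · exact finish W D I h2 hI hc
    · push Not at hc
      refine ih (W ⊓ ⨅ j ∈ I, K j) (D + r * I.card) ?_ ?_ ?_
      · intro i
        by_cases hi : i ∈ I
        · have : (W ⊓ ⨅ j ∈ I, K j) ⊓ K i = W ⊓ ⨅ j ∈ I, K j :=
            inf_eq_left.2 (inf_le_right.trans (iInf₂_le i hi))
          rw [this]
          omega
        · exact finrank_drop W _ (K i) inf_le_left (hm i hi) s (h1 i)
      · have := finrank_iInf K hr W I
        omega
      · refine le_trans ?_ h3
        rw [pow_succ, mul_assoc, mul_assoc, mul_assoc]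
        refine Nat.mul_le_mul_left _ (Nat.mul_le_mul_left _ ?_)
        have : r * I.card ≤ r * (M * (D + T)) := Nat.mul_le_mul_left _ hc.le
        nlinarith

lemma hM_lemma (r : ℕ) : (1 - ((1/3) * (1/2:ℝ)^r)^2/20) ^ (2 ^ (2 * r + 8)) ≤ 1/2 := by
  have hp1 : (1/2:ℝ)^r ≤ 1 := pow_le_one₀ (by norm_num) (by norm_num)
  have hp0 : 0 < (1/2:ℝ)^r := by positivity
  have h0 : 0 ≤ 1 - ((1/3) * (1/2:ℝ)^r)^2/20 := by nlinarith
  have h1 : 1 - ((1/3) * (1/2:ℝ)^r)^2/20 ≤ Real.exp (-(((1/3) * (1/2:ℝ)^r)^2/20)) := by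
    have := Real.add_one_le_exp (-(((1/3) * (1/2:ℝ)^r)^2/20))
    linarith
  refine (pow_le_pow_left₀ h0 h1 _).trans ?_
  rw [← Real.exp_nat_mul]
  have e : ((2 ^ (2 * r + 8) : ℕ) : ℝ) * (-(((1/3) * (1/2:ℝ)^r)^2/20)) = -(256/180) := by
    push_cast
    rw [pow_add, pow_mul']
    have : (2:ℝ)^r * (1/2:ℝ)^r = 1 := by rw [← mul_pow]; norm_num
    calc _ = -(256/180) * ((2:ℝ)^r * (1/2:ℝ)^r)^2 := by ring
      _ = _ := by rw [this]; ring
  rw [e, Real.exp_neg, one_div]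
  apply inv_anti₀ (by norm_num)
  have := Real.add_one_le_exp (256/180:ℝ)
  linarith

lemma size_lemma (r : ℕ) (hr : 1 ≤ r) :
    2 ^ (2 * r + 8) * (1 + r * 2 ^ (2 * r + 8)) ^ r ≤ 2 ^ (21 * r ^ 2) := by
  have h1 : 1 + r * 2 ^ (2 * r + 8) ≤ 2 ^ (11 * r) := by
    have a : r + 1 ≤ 2 ^ r := Nat.lt_two_pow_self
    calc 1 + r * 2 ^ (2 * r + 8) ≤ (r + 1) * 2 ^ (2 * r + 8) := by
          have : 1 ≤ 2 ^ (2 * r + 8) := Nat.one_le_two_pow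
          nlinarith
      _ ≤ 2 ^ r * 2 ^ (2 * r + 8) := Nat.mul_le_mul_right _ a
      _ = 2 ^ (r + (2 * r + 8)) := (pow_add _ _ _).symm
      _ ≤ _ := Nat.pow_le_pow_right (by norm_num) (by omega)
  calc _ ≤ 2 ^ (2 * r + 8) * (2 ^ (11 * r)) ^ r := Nat.mul_le_mul_left _ (Nat.pow_le_pow_left h1 r)
    _ = 2 ^ (2 * r + 8 + 11 * r * r) := by rw [← pow_mul, ← pow_add]
    _ ≤ _ := Nat.pow_le_pow_right (by norm_num) (by nlinarith)

end helpers3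

/-- bounded linear rank distributions (sunflower version) are
`1 - C·2^{r/2}/n^{1/(r+1)}`-far from `Ber(1/3)^{⊗n}` when `r ≤ c·√(log₂ n)`. -/
theorem bounded_linear_rank_sunflower_lower_bound :
    ∃ c > (0:ℝ), ∃ C > (0:ℝ), ∀ m n : ℕ, 0 < m → 0 < n →
      ∀ r : ℕ, 1 ≤ r → (r:ℝ) ≤ c * Real.sqrt (Real.logb 2 (n:ℝ)) →
      ∀ P : Fin n → (Fin m → ZMod 2) → ZMod 2, (∀ i, RankLE 1 r (P i)) →
        tvDist (outDist P) ber13 ≥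
          1 - C * (2:ℝ) ^ ((r:ℝ)/2) / (n:ℝ) ^ ((1:ℝ)/((r:ℝ)+1)) := by
  refine ⟨1/10, by norm_num, 2, by norm_num, ?_⟩
  intro m n _ hn r hr hrn P hP
  rw [tv_ge]
  choose K hK hKr using fun i => exists_K (P i) (hP i)
  have hn1 : (1:ℝ) ≤ n := by exact_mod_cast hn
  have hlog : 0 ≤ Real.logb 2 (n:ℝ) := Real.logb_nonneg (by norm_num) hn1
  have hbig : 2 ^ (42 * r ^ 2) ≤ n := by
    have h1 : (r:ℝ)^2 ≤ (1/100) * Real.logb 2 n := by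
      calc (r:ℝ)^2 ≤ (1/10 * Real.sqrt (Real.logb 2 (n:ℝ)))^2 := by gcongr
        _ = _ := by rw [mul_pow, Real.sq_sqrt hlog]; norm_num
    have h2 : ((42 * r^2 : ℕ) : ℝ) ≤ Real.logb 2 n := by push_cast; linarith
    rw [Real.le_logb_iff_rpow_le (by norm_num) (by linarith), Real.rpow_natCast] at h2
    exact_mod_cast h2
  set T := Nat.sqrt n with hT
  have hT1 : 2 ^ (21 * r ^ 2) ≤ T := by
    rw [hT, Nat.le_sqrt, ← pow_add]
    refine le_trans (le_of_eq ?_) hbig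
    congr 1; ring
  have hsz : 2 ^ (2 * r + 8) * (1 + r * 2 ^ (2 * r + 8)) ^ r * (0 + T) ≤ n := by
    rw [zero_add]
    exact (Nat.mul_le_mul_right _ ((size_lemma r hr).trans hT1)).trans (Nat.sqrt_le n)
  have hmain := main_ind (T := T) P K hK hKr (hM_lemma r) r ⊤ 0
    (by intro i; rw [top_inf_eq, finrank_top, Module.finrank_fin_fun]; exact hKr i)
    (by rw [finrank_top, Module.finrank_fin_fun]; omega) hsz
  have h3 : (1/2:ℝ)^T ≤ 1 / (n:ℝ) ^ ((1:ℝ)/((r:ℝ)+1)) := by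
    rw [one_div_pow]
    apply one_div_le_one_div_of_le (by positivity)
    have hr1 : (1:ℝ) ≤ r := by exact_mod_cast hr
    calc (n:ℝ) ^ ((1:ℝ)/((r:ℝ)+1)) ≤ (n:ℝ) ^ ((1:ℝ)/2) := by
          apply Real.rpow_le_rpow_of_exponent_le hn1
          apply one_div_le_one_div_of_le (by norm_num)
          linarith
      _ = Real.sqrt n := (Real.sqrt_eq_rpow _).symm
      _ ≤ (T:ℝ) + 1 := by
          apply Real.sqrt_le_iff.2
          refine ⟨by positivity, ?_⟩
          have := (Nat.lt_succ_sqrt n).le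
          rw [← hT] at this
          have h : ((n:ℕ):ℝ) ≤ ((T.succ * T.succ : ℕ) : ℝ) := by exact_mod_cast this
          push_cast at h
          nlinarith
      _ ≤ 2 ^ T := by
          have : T + 1 ≤ 2 ^ T := Nat.lt_two_pow_self
          exact_mod_cast this
  have h4 : (1:ℝ) ≤ (2:ℝ) ^ ((r:ℝ)/2) := Real.one_le_rpow (by norm_num) (by positivity)
  have hpos : 0 ≤ 1 / (n:ℝ) ^ ((1:ℝ)/((r:ℝ)+1)) := by positivity
  have h5 : 2 * (2:ℝ) ^ ((r:ℝ)/2) / (n:ℝ) ^ ((1:ℝ)/((r:ℝ)+1))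
      = 2 * ((2:ℝ) ^ ((r:ℝ)/2) * (1 / (n:ℝ) ^ ((1:ℝ)/((r:ℝ)+1)))) := by ring
  rw [h5]
  have h6 := le_mul_of_one_le_left hpos h4
  linarith
end

section
/- There exist an absolute constant c > 0 and a threshold n₀ such that the following holds. For all n ≥ n₀, all m, and all functions Q₁,…,Qₙ : 𝔽₂^m → 𝔽₂ each of degree at most 2, ‖(Q₁,…,Qₙ) − Ber(1/3)^⊗n‖_TV ≥ 1 − n^{−c/log₂ log₂ n}. -/
open Finset

set_option linter.unusedSectionVars false
set_option linter.unusedVariables false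
noncomputable section

def chi (a : ZMod 2) : ℝ := if a = 0 then 1 else -1

lemma chi_add (a b : ZMod 2) : chi (a + b) = chi a * chi b := by
  have h : ∀ a b : ZMod 2, (a = 0 ∧ a + b = b) ∨ (a ≠ 0 ∧ b = 0 ∧ a + b ≠ 0) ∨
      (a ≠ 0 ∧ b ≠ 0 ∧ a + b = 0) := by decide
  rcases h a b with ⟨h1, h2⟩ | ⟨h1, h2, h3⟩ | ⟨h1, h2, h3⟩ <;> simp [chi, *]

lemma z2 (a : ZMod 2) : a = 0 ∨ a = 1 := by
  revert a; decide

lemma z2_self (a : ZMod 2) : a + a = 0 := by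
  fin_cases a <;> decide

variable {V : Type} [AddCommGroup V] [Module (ZMod 2) V]

section
variable [Fintype V]

def bias (f : V → ZMod 2) : ℝ := (∑ x, chi (f x)) / (Fintype.card V : ℝ)

def IsQuad (R : V → ZMod 2) : Prop :=
  ∀ x a b, R (x + a + b) + R (x + a) + R (x + b) + R x = R (a + b) + R a + R b + R 0

def InvS (R : V → ZMod 2) : Submodule (ZMod 2) V where
  carrier := {a | ∀ x, R (x + a) = R x}
  add_mem' := by
    intro a b ha hb x
    rw [← add_assoc, hb, ha]
  zero_mem' := by intro x; simp
  smul_mem' := by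
    intro c a ha
    rcases z2 c with h | h
    · subst h; intro x; simp
    · subst h; intro x; simpa using ha x

lemma mem_InvS (R : V → ZMod 2) (a : V) : a ∈ InvS R ↔ ∀ x, R (x + a) = R x := Iff.rfl

lemma sum_shift_s4 (f : V → ℝ) (a : V) : ∑ x, f (x + a) = ∑ x, f x :=
  Equiv.sum_comp (Equiv.addRight a) f

lemma bias_sq (R : V → ZMod 2) (hR : IsQuad R) :
    bias R = 0 ∨ bias R ^ 2 * (Fintype.card V : ℝ) = (Nat.card (InvS R) : ℝ) := by
  classical
  by_cases hz : (∑ x, chi (R x)) = 0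
  · left; simp [bias, hz]
  right
  -- no antisymmetric shift
  have hno : ∀ (f : V → ZMod 2) (b : V), (∀ x, f (x + b) = f x + 1) → ∑ x, chi (f x) = 0 := by
    intro f b hb
    have h1 := sum_shift_s4 (fun x => chi (f x)) b
    simp only [hb, chi_add] at h1
    rw [← Finset.sum_mul] at h1
    have : chi 1 = -1 := by simp [chi]
    rw [this] at h1
    linarith
  have key : ∀ a : V, ∑ x, chi (R x + R (x + a)) =
      if a ∈ InvS R then (Fintype.card V : ℝ) else 0 := by
    intro a
    split_ifs with ha
    · have : ∀ x, chi (R x + R (x + a)) = 1 := by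
        intro x; rw [(mem_InvS R a).1 ha x, z2_self]; simp [chi]
      simp [this]
    · by_cases hb : ∃ b, R (a + b) + R a + R b + R 0 = 1
      · obtain ⟨b, hb⟩ := hb
        apply hno _ b
        intro x
        have h2 := hR x a b
        rw [hb] at h2
        have e : x + b + a = x + a + b := by abel
        rw [e]
        generalize R (x + a + b) = p at *
        generalize R (x + a) = q at *
        generalize R (x + b) = r at *
        generalize R x = s at *
        revert h2; revert p q r s; decide
      · push Not at hb
        exfalso
        -- then the difference is constant
        have hc : ∀ x, R (x + a) = R x + (R a + R 0) := by
          intro x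
          have h2 := hb x
          clear hb
          have e : a + x = x + a := by abel
          rw [e] at h2
          generalize R (x + a) = p at *
          generalize R x = q at *
          generalize R a = r at *
          generalize R 0 = s at *
          revert h2; revert p q r s; decide
        rcases z2 (R a + R 0) with h0 | h0
        · apply ha; intro x; rw [hc, h0, add_zero]
        · apply hz; exact hno R a (fun x => by rw [hc, h0])
  have hV : (Fintype.card V : ℝ) ≠ 0 := by
    have : 0 < Fintype.card V := Fintype.card_pos_iff.2 ⟨0⟩
    positivity
  have hsq : (∑ x, chi (R x)) ^ 2 = (Nat.card (InvS R) : ℝ) * (Fintype.card V : ℝ) := by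
    have h1 : (∑ x, chi (R x)) ^ 2 = ∑ a, ∑ x, chi (R x + R (x + a)) := by
      rw [Finset.sum_comm, sq, Finset.sum_mul]
      refine Finset.sum_congr rfl fun x _ => ?_
      simp only [chi_add]
      rw [← Finset.mul_sum]
      congr 1
      have := sum_shift_s4 (fun y => chi (R y)) x
      simp only [add_comm x]
      exact this.symm
    rw [h1, Finset.sum_congr rfl (fun a _ => key a), Finset.sum_ite]
    rw [Nat.card_eq_fintype_card, Fintype.card_subtype]
    simp
  rw [bias, div_pow, hsq]
  field_simp

end

def codim (U : Submodule (ZMod 2) V) : ℕ := Module.finrank (ZMod 2) (V ⧸ U)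

lemma card_quot [Finite V] (U : Submodule (ZMod 2) V) : Nat.card (V ⧸ U) = 2 ^ codim U := by
  rw [Module.natCard_eq_pow_finrank (K := ZMod 2)]
  simp [codim]

section
variable [Fintype V]

lemma bias_sq' (R : V → ZMod 2) (hR : IsQuad R) :
    bias R = 0 ∨ bias R ^ 2 * 2 ^ codim (InvS R) = 1 := by
  rcases bias_sq R hR with h | h
  · exact Or.inl h
  right
  have h1 := Submodule.card_eq_card_quotient_mul_card (InvS R)
  rw [card_quot, Nat.card_eq_fintype_card] at h1
  have hp : (0:ℝ) < Nat.card (InvS R) := by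
    have : 0 < Nat.card (InvS R) := Nat.card_pos
    exact_mod_cast this
  rw [h1] at h
  push_cast at h
  have h2 : (bias R ^ 2 * 2 ^ codim (InvS R) - 1) * (Nat.card (InvS R) : ℝ) = 0 := by linarith
  rcases mul_eq_zero.1 h2 with h3 | h3
  · linarith
  · linarith

lemma indep_sum (E F : V → ℝ) (U W : Submodule (ZMod 2) V)
    (hE : ∀ x, ∀ u ∈ U, E (x + u) = E x) (hF : ∀ x, ∀ u ∈ W, F (x + u) = F x)
    (h : U ⊔ W = ⊤) :
    (∑ x, E x * F x) * (Fintype.card V : ℝ) = (∑ x, E x) * (∑ x, F x) := by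
  classical
  have gen : ∀ E : V → ℝ, (∀ x, ∀ u ∈ U, E (x + u) = E x) →
      (Fintype.card U : ℝ) * ∑ x, E x * F x = (∑ x, E x) * ∑ u : U, F u := by
    intro E hE
    have h1 : ∀ u : U, ∑ x, E x * F x = ∑ x, E x * F (x + u) := by
      intro u
      rw [← sum_shift_s4 (fun x => E x * F x) (u : V)]
      exact Finset.sum_congr rfl fun x _ => by rw [hE x u u.2]
    have h2 : (Fintype.card U : ℝ) * ∑ x, E x * F x = ∑ u : U, ∑ x, E x * F (x + u) := by
      rw [← Finset.sum_congr rfl (fun u _ => h1 u)]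
      simp
    rw [h2, Finset.sum_comm, Finset.sum_mul]
    refine Finset.sum_congr rfl fun x _ => ?_
    rw [← Finset.mul_sum]
    congr 1
    have hx : x ∈ U ⊔ W := by rw [h]; trivial
    obtain ⟨u0, hu0, w, hw, rfl⟩ := Submodule.mem_sup.1 hx
    have h3 : ∀ u : U, F (u0 + w + u) = F ((u + ⟨u0, hu0⟩ : U) : V) := by
      intro u
      have : u0 + w + (u:V) = (u + u0) + w := by abel
      rw [this, hF _ w hw]; rfl
    rw [Finset.sum_congr rfl (fun u _ => h3 u)]
    exact Equiv.sum_comp (Equiv.addRight (⟨u0, hu0⟩ : U)) (fun u : U => F u)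
  have a := gen E hE
  have b := gen (fun _ => 1) (fun _ _ _ => rfl)
  simp only [one_mul, Finset.sum_const, Finset.card_univ, nsmul_eq_mul, mul_one] at b
  have hU : (Fintype.card U : ℝ) ≠ 0 := by
    have : 0 < Fintype.card U := Fintype.card_pos_iff.2 ⟨0⟩
    positivity
  apply mul_left_cancel₀ hU
  calc (Fintype.card U : ℝ) * ((∑ x, E x * F x) * (Fintype.card V : ℝ))
      = ((Fintype.card U : ℝ) * (∑ x, E x * F x)) * (Fintype.card V : ℝ) := by ring
    _ = (∑ x, E x) * ((Fintype.card V : ℝ) * ∑ u : U, F u) := by rw [a]; ring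
    _ = _ := by rw [← b]; ring

end

lemma codim_inf [Finite V] (U W : Submodule (ZMod 2) V) : codim (U ⊓ W) ≤ codim U + codim W := by
  have hk : LinearMap.ker (U.mkQ.prod W.mkQ) = U ⊓ W := by
    rw [LinearMap.ker_prod]; simp
  have e := (LinearMap.quotKerEquivRange (U.mkQ.prod W.mkQ)).finrank_eq
  unfold codim
  rw [← hk, e, ← Module.finrank_prod]
  exact Submodule.finrank_le _

lemma codim_anti [Finite V] {U W : Submodule (ZMod 2) V} (h : U ≤ W) : codim W ≤ codim U := by
  unfold codim
  apply LinearMap.finrank_le_finrank_of_surjective (f := Submodule.factor h)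
  exact Submodule.factor_surjective h

lemma codim_restrict [Finite V] (U W : Submodule (ZMod 2) V) (h : U ⊔ W ≠ ⊤) :
    codim (W.comap U.subtype) < codim W := by
  have hk : LinearMap.ker (W.mkQ ∘ₗ U.subtype) = W.comap U.subtype := by
    rw [LinearMap.ker_comp]; simp
  have e := (LinearMap.quotKerEquivRange (W.mkQ ∘ₗ U.subtype)).finrank_eq
  unfold codim
  rw [← hk, e]
  apply Submodule.finrank_lt
  intro htop
  apply h
  rw [LinearMap.range_comp, Submodule.range_subtype] at htop
  have := congrArg (Submodule.comap W.mkQ) htop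
  rw [Submodule.comap_map_mkQ, Submodule.comap_top] at this
  rw [sup_comm]; exact this

lemma codim_finset [Finite V] {ι : Type} (S : Finset ι) (U : ι → Submodule (ZMod 2) V) (d : ℕ)
    (hd : ∀ i, codim (U i) ≤ d) : codim (S.inf U) ≤ S.card * d := by
  classical
  induction S using Finset.induction_on with
  | empty =>
    have : Subsingleton (V ⧸ (⊤ : Submodule (ZMod 2) V)) := inferInstance
    simp [codim, Module.finrank_zero_of_subsingleton]
  | insert i S hi ih =>
    rw [Finset.inf_insert, Finset.card_insert_of_notMem hi]
    have := codim_inf (U i) (S.inf U)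
    have := hd i
    nlinarith

def wt (b : ZMod 2) : ℝ := if b = 1 then 1 / 3 else 2 / 3

def nu {ι : Type} [Fintype ι] (y : ι → ZMod 2) : ℝ := ∏ i, wt (y i)

def ov {α ι : Type} [Fintype α] [Fintype ι] [DecidableEq ι] (f : α → ι → ZMod 2) : ℝ :=
  ∑ y, min (distOf f y) (nu y)

lemma wt_pos (b : ZMod 2) : 0 < wt b := by
  unfold wt; split_ifs <;> norm_num

lemma sum_z2 (f : ZMod 2 → ℝ) : ∑ b, f b = f 0 + f 1 := Fin.sum_univ_two f

lemma wt_zero : wt 0 = 2 / 3 := by simp [wt]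

lemma wt_one : wt 1 = 1 / 3 := by simp [wt]

lemma nu_nonneg {ι : Type} [Fintype ι] (y : ι → ZMod 2) : 0 ≤ nu y :=
  Finset.prod_nonneg fun i _ => (wt_pos _).le

lemma nu_sum {ι : Type} [Fintype ι] [DecidableEq ι] : ∑ y : ι → ZMod 2, nu y = 1 := by
  unfold nu
  rw [← Fintype.prod_sum]
  simp only [sum_z2, wt_zero, wt_one]
  norm_num

lemma distOf_nonneg {α β : Type} [Fintype α] [DecidableEq β] (f : α → β) (y : β) :
    0 ≤ distOf f y := by
  unfold distOf; positivity

lemma distOf_eq {α β : Type} [Fintype α] [DecidableEq β] (f : α → β) (y : β) :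
    distOf f y = (∑ x, if f x = y then (1:ℝ) else 0) / (Fintype.card α : ℝ) := by
  unfold distOf; simp

lemma distOf_sum {α β : Type} [Fintype α] [Nonempty α] [Fintype β] [DecidableEq β] (f : α → β) :
    ∑ y, distOf f y = 1 := by
  simp only [distOf_eq]
  rw [← Finset.sum_div, Finset.sum_comm]
  simp

lemma ov_union {α α' τ ι : Type} [Fintype α] [Fintype α'] [Fintype τ] [Fintype ι] [DecidableEq ι]
    (f : α → ι → ZMod 2) (g : τ → α' → ι → ZMod 2)
    (h : ∀ y, distOf f y ≤ ∑ t, distOf (g t) y) : ov f ≤ ∑ t, ov (g t) := by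
  unfold ov
  rw [Finset.sum_comm]
  refine Finset.sum_le_sum fun y _ => ?_
  by_cases hc : ∃ t, nu y ≤ distOf (g t) y
  · obtain ⟨t, ht⟩ := hc
    calc min (distOf f y) (nu y) ≤ nu y := min_le_right _ _
      _ = min (distOf (g t) y) (nu y) := (min_eq_right ht).symm
      _ ≤ _ := Finset.single_le_sum (f := fun t => min (distOf (g t) y) (nu y))
          (fun t _ => le_min (distOf_nonneg _ _) (nu_nonneg _)) (Finset.mem_univ t)
  · push Not at hc
    calc min (distOf f y) (nu y) ≤ distOf f y := min_le_left _ _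
      _ ≤ _ := h y
      _ = _ := Finset.sum_congr rfl fun t _ => (min_eq_left (hc t).le).symm

lemma ov_marg {α ι : Type} [Fintype α] [Fintype ι] [DecidableEq ι] (p : ι → Prop)
    [DecidablePred p] (f : α → ι → ZMod 2) :
    ov f ≤ ov (fun x (i : {i // p i}) => f x i) := by
  unfold ov
  let e := Equiv.piEquivPiSubtypeProd p (fun _ : ι => ZMod 2)
  rw [← Equiv.sum_comp e.symm, Fintype.sum_prod_type]
  refine Finset.sum_le_sum fun z _ => ?_
  apply le_min
  · calc ∑ z', min (distOf f (e.symm (z, z'))) (nu (e.symm (z, z')))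
        ≤ ∑ z', distOf f (e.symm (z, z')) := Finset.sum_le_sum fun _ _ => min_le_left _ _
      _ ≤ _ := by
        simp only [distOf_eq]
        rw [← Finset.sum_div, Finset.sum_comm]
        gcongr with x hx
        have h1 : ∀ z', (f x = e.symm (z, z')) ↔
            ((fun i : {i // p i} => f x i) = z ∧ (fun i : {i // ¬ p i} => f x i) = z') := by
          intro z'
          rw [Equiv.eq_symm_apply, Prod.ext_iff]
          rfl
        simp only [h1]
        by_cases hz : (fun i : {i // p i} => f x i) = z
        · simp [hz]
        · simp [hz]
  · calc ∑ z', min (distOf f (e.symm (z, z'))) (nu (e.symm (z, z')))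
        ≤ ∑ z', nu (e.symm (z, z')) := Finset.sum_le_sum fun _ _ => min_le_right _ _
      _ = ∑ z', nu z * nu z' := by
        refine Finset.sum_congr rfl fun z' _ => ?_
        unfold nu
        rw [← Fintype.prod_subtype_mul_prod_subtype p]
        congr 1
        · refine Finset.prod_congr rfl fun i _ => ?_
          simp [e, Equiv.piEquivPiSubtypeProd, i.2]
        · refine Finset.prod_congr rfl fun i _ => ?_
          simp [e, Equiv.piEquivPiSubtypeProd, i.2]
      _ = nu z := by rw [← Finset.mul_sum, nu_sum, mul_one]
      _ ≤ _ := le_refl _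

def gam : ℝ := 1 - 1 / 80000

lemma bc_le (q : ZMod 2 → ℝ) (h0 : 0 ≤ q 0) (h1 : 0 ≤ q 1) (hs : q 0 + q 1 = 1)
    (hg : 1 / 100 ≤ |q 1 - 1 / 3|) : ∑ b, √(q b * wt b) ≤ gam := by
  rw [sum_z2, wt_zero, wt_one, Real.sqrt_mul h0, Real.sqrt_mul h1]
  have a0 := Real.sq_sqrt h0
  have a1 := Real.sq_sqrt h1
  have b0 := Real.sq_sqrt (show (0:ℝ) ≤ 2 / 3 by norm_num)
  have b1 := Real.sq_sqrt (show (0:ℝ) ≤ 1 / 3 by norm_num)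
  have p1 := Real.sqrt_nonneg (q 1)
  have p2 := Real.sqrt_nonneg (1 / 3 : ℝ)
  have l1 : √(q 1) ≤ 1 := Real.sqrt_le_iff.2 ⟨by norm_num, by linarith⟩
  have l2 : √(1 / 3 : ℝ) ≤ 1 := Real.sqrt_le_iff.2 ⟨by norm_num, by norm_num⟩
  set x := √(q 1)
  set y := √(1 / 3 : ℝ)
  set u := √(q 0)
  set v := √(2 / 3 : ℝ)
  have e : q 1 - 1 / 3 = (x - y) * (x + y) := by nlinarith
  have h3 : (1 / 100 : ℝ) ^ 2 ≤ (q 1 - 1 / 3) ^ 2 := by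
    rw [← sq_abs (q 1 - 1 / 3)]; gcongr
  have h4 : (q 1 - 1 / 3) ^ 2 ≤ (x - y) ^ 2 * 4 := by
    rw [e, mul_pow]
    gcongr
    nlinarith
  have h5 := sq_nonneg (u - v)
  unfold gam
  nlinarith

lemma ov_prod {α ι : Type} [Fintype α] [Fintype ι] [DecidableEq ι] (f : α → ι → ZMod 2)
    (K : ℝ) (hK : 1 ≤ K) (q : ι → ZMod 2 → ℝ) (hq : ∀ i b, 0 ≤ q i b)
    (hs : ∀ i, q i 0 + q i 1 = 1) (hg : ∀ i, 1 / 100 ≤ |q i 1 - 1 / 3|)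
    (h : ∀ y, distOf f y ≤ K * ∏ i, q i (y i)) : ov f ≤ K * gam ^ Fintype.card ι := by
  have h1 : ∀ y : ι → ZMod 2, min (distOf f y) (nu y) ≤ K * ∏ i, √(q i (y i) * wt (y i)) := by
    intro y
    have hP : 0 ≤ ∏ i, √(q i (y i) * wt (y i)) := Finset.prod_nonneg fun _ _ => Real.sqrt_nonneg _
    have hm : 0 ≤ min (distOf f y) (nu y) := le_min (distOf_nonneg _ _) (nu_nonneg _)
    apply le_of_pow_le_pow_left₀ two_ne_zero (by positivity)
    have h2 : (∏ i, √(q i (y i) * wt (y i))) ^ 2 = (∏ i, q i (y i)) * nu y := by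
      rw [← Finset.prod_pow, nu, ← Finset.prod_mul_distrib]
      exact Finset.prod_congr rfl fun i _ => Real.sq_sqrt (mul_nonneg (hq _ _) (wt_pos _).le)
    rw [mul_pow, h2]
    have hn := nu_nonneg y
    have hQ : 0 ≤ ∏ i, q i (y i) := Finset.prod_nonneg fun _ _ => hq _ _
    calc (min (distOf f y) (nu y)) ^ 2 = min (distOf f y) (nu y) * min (distOf f y) (nu y) := sq _
      _ ≤ distOf f y * nu y := mul_le_mul (min_le_left _ _) (min_le_right _ _) hm (distOf_nonneg _ _)
      _ ≤ (K * ∏ i, q i (y i)) * nu y := by gcongr; exact h y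
      _ ≤ (K ^ 2 * ∏ i, q i (y i)) * nu y := by
        gcongr; nlinarith
      _ = _ := by ring
  unfold ov
  calc _ ≤ ∑ y : ι → ZMod 2, K * ∏ i, √(q i (y i) * wt (y i)) := Finset.sum_le_sum fun y _ => h1 y
    _ = K * ∏ i, ∑ b, √(q i b * wt b) := by
      rw [← Finset.mul_sum, ← Fintype.prod_sum (fun i b => √(q i b * wt b))]
    _ ≤ K * ∏ i : ι, gam := by
      gcongr with i hi
      exact bc_le _ (hq _ _) (hq _ _) (hs _) (hg _)
    _ = _ := by simp

lemma ov_subset {α ι : Type} [Fintype α] [Fintype ι] [DecidableEq ι] (R : ι → α → ZMod 2)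
    (S : Finset ι)
    (K : ℝ) (hK : 1 ≤ K) (q : ι → ZMod 2 → ℝ) (hq : ∀ i b, 0 ≤ q i b)
    (hs : ∀ i, q i 0 + q i 1 = 1) (hg : ∀ i, 1 / 100 ≤ |q i 1 - 1 / 3|)
    (h : ∀ y : ι → ZMod 2, (∑ x : α, if ∀ i ∈ S, R i x = y i then (1:ℝ) else 0) /
      (Fintype.card α : ℝ) ≤ K * ∏ i ∈ S, q i (y i)) :
    ov (fun x i => R i x) ≤ K * gam ^ S.card := by
  refine (ov_marg (fun i => i ∈ S) (fun x i => R i x)).trans ?_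
  have hc : Fintype.card {i // i ∈ S} = S.card := Fintype.card_coe S
  rw [← hc]
  suffices hsuf : ov (fun (x : α) (i : {i // i ∈ S}) => R i x) ≤
      K * gam ^ Fintype.card {i // i ∈ S} by
    refine le_trans (le_of_eq ?_) hsuf
    congr!
  refine ov_prod (ι := {i // i ∈ S}) (fun (x : α) (i : {i // i ∈ S}) => R i x) K hK
    (fun i => q i) (fun i => hq i) (fun i => hs i) (fun i => hg i) ?_
  intro z
  let y : ι → ZMod 2 := fun i => if h : i ∈ S then z ⟨i, h⟩ else 0
  have hy : ∀ i : {i // i ∈ S}, y i = z i := by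
    intro i; simp [y]
  have h1 := h y
  have h2 : ∏ i ∈ S, q i (y i) = ∏ i : {i // i ∈ S}, q i (z i) := by
    rw [← Finset.prod_coe_sort]
    exact Finset.prod_congr rfl fun i _ => by rw [hy]
  rw [h2] at h1
  refine le_trans (le_of_eq ?_) h1
  rw [distOf_eq]
  congr 1
  refine Finset.sum_congr rfl fun x _ => ?_
  have : ((fun i : {i // i ∈ S} => R i x) = z) ↔ ∀ i ∈ S, R i x = y i := by
    constructor
    · intro h i hi
      have := congrFun h ⟨i, hi⟩
      rw [← hy] at this
      exact this
    · intro h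
      funext i
      rw [← hy]; exact h i i.2
  simp only [this]

lemma bias_eq {V : Type} [Fintype V] [AddCommGroup V] [Module (ZMod 2) V] (R : V → ZMod 2) :
    bias R = distOf R 0 - distOf R 1 := by
  rw [distOf_eq, distOf_eq, ← sub_div, bias, ← Finset.sum_sub_distrib]
  congr 1
  refine Finset.sum_congr rfl fun x _ => ?_
  rcases z2 (R x) with h | h <;> simp [h, chi]

lemma dist_add {α : Type} [Fintype α] [Nonempty α] (R : α → ZMod 2) :
    distOf R 0 + distOf R 1 = 1 := by
  rw [← sum_z2 (distOf R), distOf_sum]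

lemma quad_gap {V : Type} [Fintype V] [AddCommGroup V] [Module (ZMod 2) V] (R : V → ZMod 2)
    (hR : IsQuad R) : 1 / 100 ≤ |distOf R 1 - 1 / 3| := by
  have h1 := bias_eq R
  have h2 := dist_add R
  have hb : bias R = 1 - 2 * distOf R 1 := by linarith
  have key : bias R ≤ 1 / 3 - 1 / 50 ∨ 1 / 3 + 1 / 50 ≤ bias R := by
    rcases bias_sq' R hR with h | h
    · left; rw [h]; norm_num
    · by_contra hc
      push Not at hc
      obtain ⟨c1, c2⟩ := hc
      have hp : 0 < bias R := by linarith
      have s1 : bias R ^ 2 < 1 / 8 := by nlinarith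
      have s2 : 1 / 16 < bias R ^ 2 := by nlinarith
      have hj : codim (InvS R) ≤ 3 ∨ 4 ≤ codim (InvS R) := by omega
      rcases hj with hj | hj
      · have : (2:ℝ) ^ codim (InvS R) ≤ 2 ^ 3 := pow_le_pow_right₀ (by norm_num) hj
        nlinarith
      · have : (2:ℝ) ^ 4 ≤ 2 ^ codim (InvS R) := pow_le_pow_right₀ (by norm_num) hj
        nlinarith
  rw [le_abs]
  rcases key with h | h
  · left; linarith
  · right; linarith

def IndepS {V ι : Type} [Fintype V] (R : ι → V → ZMod 2) (S : Finset ι) : Prop :=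
  ∀ y : ι → ZMod 2, (∑ x, if ∀ i ∈ S, R i x = y i then (1:ℝ) else 0) / (Fintype.card V : ℝ)
    = ∏ i ∈ S, distOf (R i) (y i)

lemma indep_empty {V ι : Type} [Fintype V] [Nonempty V] (R : ι → V → ZMod 2) : IndepS R ∅ := by
  intro y; simp

lemma indep_insert {V ι : Type} [Fintype V] [AddCommGroup V] [Module (ZMod 2) V] [DecidableEq ι]
    (R : ι → V → ZMod 2) (S : Finset ι) (i : ι) (hi : i ∉ S) (hS : IndepS R S)
    (h : S.inf (fun j => InvS (R j)) ⊔ InvS (R i) = ⊤) : IndepS R (insert i S) := by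
  intro y
  have h1 := indep_sum (fun x => if ∀ j ∈ S, R j x = y j then (1:ℝ) else 0)
    (fun x => if R i x = y i then (1:ℝ) else 0) _ _ ?_ ?_ h
  · have hV : (Fintype.card V : ℝ) ≠ 0 := by
      have : 0 < Fintype.card V := Fintype.card_pos_iff.2 ⟨0⟩
      positivity
    rw [Finset.prod_insert hi, ← hS y, distOf_eq, div_mul_div_comm, mul_comm (∑ x, _), ← h1,
      mul_div_mul_right _ _ hV]
    congr 1
    refine Finset.sum_congr rfl fun x _ => ?_
    simp only [Finset.forall_mem_insert, ite_and]
    split_ifs <;> simp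
  · intro x u hu
    have : ∀ j ∈ S, R j (x + u) = R j x := by
      intro j hj
      have : u ∈ InvS (R j) := (Finset.inf_le (f := fun j => InvS (R j)) hj) hu
      exact this x
    have e : (∀ j ∈ S, R j (x + u) = y j) ↔ (∀ j ∈ S, R j x = y j) :=
      forall₂_congr fun j hj => by rw [this j hj]
    simp only [e]
  · intro x u hu
    simp only [(mem_InvS _ _).1 hu x]

lemma coset_bound {V β : Type} [Fintype V] [AddCommGroup V] [Module (ZMod 2) V] [DecidableEq β]
    (U : Submodule (ZMod 2) V) [Fintype U] [Fintype (V ⧸ U)] (f : V → β) (y : β) :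
    distOf f y ≤ ∑ q : V ⧸ U, distOf (fun u : U => f (q.out + u)) y := by
  classical
  simp only [distOf_eq]
  rw [← Finset.sum_div]
  have h1 : ∑ x, (if f x = y then (1:ℝ) else 0) =
      ∑ q : V ⧸ U, ∑ u : U, (if f (q.out + u) = y then (1:ℝ) else 0) := by
    rw [← Fintype.sum_prod_type' (fun (q : V ⧸ U) (u : U) =>
      (if f (q.out + u) = y then (1:ℝ) else 0))]
    symm
    refine Fintype.sum_bijective (fun p : (V ⧸ U) × U => (p.1.out : V) + p.2) ?_ _ _ (fun _ => rfl)
    constructor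
    · rintro ⟨q, u⟩ ⟨q', u'⟩ h
      simp only at h
      have hq : q = q' := by
        have := congrArg (Submodule.Quotient.mk (p := U)) h
        have o : ∀ q : V ⧸ U, Submodule.Quotient.mk (p := U) q.out = q := fun q => Quotient.out_eq' q
        have m0 : ∀ u : U, Submodule.Quotient.mk (p := U) (u : V) = 0 :=
          fun u => (Submodule.Quotient.mk_eq_zero U).2 u.2
        rw [Submodule.Quotient.mk_add, Submodule.Quotient.mk_add, o, o, m0, m0, add_zero,
          add_zero] at this
        exact this
      subst hq
      simpa using h
    · intro x
      have o : ∀ q : V ⧸ U, Submodule.Quotient.mk (p := U) q.out = q := fun q => Quotient.out_eq' q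
      have hm : x - (Submodule.Quotient.mk (p := U) x).out ∈ U := by
        rw [← Submodule.Quotient.eq, o]
      exact ⟨(Submodule.Quotient.mk x, ⟨_, hm⟩), by simp⟩
  rw [h1]
  have hU : 0 < Fintype.card U := Fintype.card_pos_iff.2 ⟨0⟩
  have hc : Fintype.card U ≤ Fintype.card V := Fintype.card_le_of_injective _ Subtype.val_injective
  gcongr

lemma ov_indep {V ι : Type} [Fintype V] [AddCommGroup V] [Module (ZMod 2) V] [Fintype ι]
    [DecidableEq ι] (R : ι → V → ZMod 2) (hR : ∀ i, IsQuad (R i)) (S : Finset ι)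
    (hS : IndepS R S) : ov (fun x i => R i x) ≤ gam ^ S.card := by
  have := ov_subset R S 1 le_rfl (fun i => distOf (R i)) (fun i b => distOf_nonneg _ _)
    (fun i => dist_add _) (fun i => quad_gap _ (hR i)) (fun y => by
      refine le_of_eq ?_; rw [one_mul]; convert hS y)
  simpa using this

lemma gam_pos : 0 < gam := by unfold gam; norm_num

lemma gam_lt : gam < 1 := by unfold gam; norm_num

theorem low_rank (C : ℕ) (hC : gam ^ C ≤ 1 / 2) (D : ℕ) : ∀ d ≤ D, ∀ (B : ℕ) (V ι : Type)
    [Fintype V] [AddCommGroup V] [Module (ZMod 2) V] [Fintype ι] [DecidableEq ι]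
    (R : ι → V → ZMod 2), (∀ i, IsQuad (R i)) → (∀ i, codim (InvS (R i)) ≤ d) →
    C * B * (1 + C * D) ^ d ≤ Fintype.card ι → ov (fun x i => R i x) ≤ (1 / 2) ^ B := by
  intro d
  induction d with
  | zero =>
    intro _ B V ι _ _ _ _ _ R hR hd hN
    have hI : ∀ S : Finset ι, IndepS R S := by
      intro S
      induction S using Finset.induction_on with
      | empty => exact indep_empty R
      | insert i S hi ih =>
        refine indep_insert R S i hi ih ?_
        have h0 := Nat.le_zero.1 (hd i)
        have : Subsingleton (V ⧸ InvS (R i)) := Module.finrank_zero_iff.1 h0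
        rw [Submodule.Quotient.subsingleton_iff.1 this, sup_top_eq]
    refine (ov_indep R hR Finset.univ (hI _)).trans ?_
    rw [pow_zero, mul_one] at hN
    calc gam ^ (Finset.univ : Finset ι).card ≤ gam ^ (C * B) :=
          pow_le_pow_of_le_one gam_pos.le gam_lt.le hN
      _ = (gam ^ C) ^ B := pow_mul _ _ _
      _ ≤ _ := pow_le_pow_left₀ (pow_pos gam_pos _).le hC _
  | succ d ih =>
    intro hdD B V ι _ _ _ _ _ R hR hd hN
    classical
    by_cases hbig : ∃ S : Finset ι, IndepS R S ∧ C * B ≤ S.card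
    · obtain ⟨S, hS, hc⟩ := hbig
      refine (ov_indep R hR S hS).trans ?_
      calc gam ^ S.card ≤ gam ^ (C * B) :=
            pow_le_pow_of_le_one gam_pos.le gam_lt.le hc
        _ = (gam ^ C) ^ B := pow_mul _ _ _
        _ ≤ _ := pow_le_pow_left₀ (pow_pos gam_pos _).le hC _
    push Not at hbig
    obtain ⟨S, hSm, hmax⟩ := Finset.exists_max_image
      (Finset.univ.filter fun S : Finset ι => IndepS R S) Finset.card
      ⟨∅, by simpa using indep_empty R⟩
    have hS : IndepS R S := by simpa using hSm
    have hcard := hbig S hS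
    set U := S.inf (fun j => InvS (R j)) with hU
    have hcod : codim U ≤ C * B * D := by
      refine (codim_finset S _ _ hd).trans ?_
      exact Nat.mul_le_mul hcard.le hdD
    have : Fintype U := Fintype.ofFinite _
    have : Fintype (V ⧸ U) := Fintype.ofFinite _
    have h1 := ov_union (fun x i => R i x)
      (fun (q : V ⧸ U) (u : U) (i : ι) => R i (q.out + u))
      (fun y => coset_bound U (fun x i => R i x) y)
    have h2 : ∀ q : V ⧸ U, ov (fun (u : U) (i : ι) => R i (q.out + u)) ≤
        (1 / 2) ^ (B + C * B * D) := by
      intro q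
      refine ih (by omega) (B + C * B * D) U ι (fun i u => R i (q.out + u)) ?_ ?_ ?_
      · intro i x a b
        have e1 := hR i (q.out + x) a b
        have e2 := hR i (q.out) a b
        simp only [Submodule.coe_add, Submodule.coe_zero, add_zero]
        simp only [← add_assoc]
        rw [e1, ← e2]
      · intro i
        have hle : (InvS (R i)).comap U.subtype ≤ InvS (fun u : U => R i (q.out + u)) := by
          intro u hu x
          have hu' : (u : V) ∈ InvS (R i) := hu
          have := hu' (q.out + x)
          simpa [add_assoc] using this
        refine (codim_anti hle).trans ?_
        by_cases hi : i ∈ S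
        · have : (InvS (R i)).comap U.subtype = ⊤ := by
            rw [Submodule.comap_subtype_eq_top]
            exact Finset.inf_le (f := fun j => InvS (R j)) hi
          rw [this]
          simp [codim, Module.finrank_zero_of_subsingleton]
        · have hne : U ⊔ InvS (R i) ≠ ⊤ := by
            intro ht
            have h3 := indep_insert R S i hi hS ht
            have h4 := hmax (insert i S) (by simpa using h3)
            rw [Finset.card_insert_of_notMem hi] at h4
            omega
          have := codim_restrict U _ hne
          have := hd i
          omega
      · calc C * (B + C * B * D) * (1 + C * D) ^ d = C * B * (1 + C * D) ^ (d + 1) := by ring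
          _ ≤ _ := hN
    refine h1.trans ((Finset.sum_le_sum fun q _ => h2 q).trans ?_)
    rw [Finset.sum_const, nsmul_eq_mul, Finset.card_univ, ← Nat.card_eq_fintype_card, card_quot]
    push_cast
    calc (2:ℝ) ^ codim U * (1 / 2) ^ (B + C * B * D)
        ≤ 2 ^ (C * B * D) * (1 / 2) ^ (B + C * B * D) := by
          gcongr; norm_num
      _ = (1 / 2) ^ B := by
        rw [pow_add, mul_comm ((1 / 2 : ℝ) ^ B), ← mul_assoc, ← mul_pow]
        norm_num

lemma chi_sum {ι : Type} (T : Finset ι) (a : ι → ZMod 2) :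
    chi (∑ i ∈ T, a i) = ∏ i ∈ T, chi (a i) := by
  classical
  induction T using Finset.induction_on with
  | empty => simp [chi]
  | insert i T hi ih => rw [Finset.sum_insert hi, Finset.prod_insert hi, chi_add, ih]

lemma chi_abs (a : ZMod 2) : |chi a| = 1 := by
  unfold chi; split_ifs <;> simp

lemma fourier_bd {V ι : Type} [Fintype V] [AddCommGroup V] [Module (ZMod 2) V] [DecidableEq ι]
    (R : ι → V → ZMod 2) (S : Finset ι)
    (h : ∀ T ⊆ S, T.Nonempty → |bias (fun x => ∑ j ∈ T, R j x)| ≤ (1 / 2) ^ S.card)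
    (y : ι → ZMod 2) :
    (∑ x : V, if ∀ i ∈ S, R i x = y i then (1:ℝ) else 0) / (Fintype.card V : ℝ)
      ≤ 2 * ∏ _i ∈ S, (1 / 2 : ℝ) := by
  have h1 : ∀ x, (if ∀ i ∈ S, R i x = y i then (1:ℝ) else 0) =
      (1 / 2) ^ S.card * ∑ T ∈ S.powerset, chi (∑ i ∈ T, y i) * chi (∑ i ∈ T, R i x) := by
    intro x
    have e1 : (if ∀ i ∈ S, R i x = y i then (1:ℝ) else 0) =
        ∏ i ∈ S, ((1 / 2) * (1 + chi (y i) * chi (R i x))) := by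
      have e0 : ∀ i, (1 / 2 : ℝ) * (1 + chi (y i) * chi (R i x)) =
          if R i x = y i then 1 else 0 := by
        intro i
        rcases z2 (R i x) with h | h <;> rcases z2 (y i) with h' | h' <;>
          simp [h, h', chi] <;> norm_num
      simp only [e0]
      rw [Finset.prod_ite_zero]
      simp
    rw [e1, Finset.prod_mul_distrib, Finset.prod_const, Finset.prod_one_add]
    congr 1
    refine Finset.sum_congr rfl fun T _ => ?_
    rw [Finset.prod_mul_distrib, chi_sum, chi_sum]
  simp only [h1]
  rw [← Finset.mul_sum, Finset.sum_comm, mul_div_assoc, Finset.sum_div, Finset.prod_const, mul_comm 2]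
  refine mul_le_mul_of_nonneg_left ?_ (by positivity)
  have h2 : ∀ T ∈ S.powerset, (∑ x, chi (∑ i ∈ T, y i) * chi (∑ i ∈ T, R i x)) /
      (Fintype.card V : ℝ) ≤ (if T = ∅ then 1 else 0) + (1 / 2) ^ S.card := by
    intro T hT
    have hV : (Fintype.card V : ℝ) ≠ 0 := by
      have : 0 < Fintype.card V := Fintype.card_pos_iff.2 ⟨0⟩
      positivity
    split_ifs with hE
    · subst hE
      simp [chi, hV]
    · have := h T (Finset.mem_powerset.1 hT) (Finset.nonempty_iff_ne_empty.2 hE)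
      rw [← Finset.mul_sum, mul_div_assoc, zero_add]
      refine (le_abs_self _).trans ?_
      rw [abs_mul, chi_abs, one_mul]
      exact this
  refine (Finset.sum_le_sum h2).trans ?_
  rw [Finset.sum_add_distrib, Finset.sum_const, Finset.card_powerset, nsmul_eq_mul]
  have : ((2 ^ S.card : ℕ) : ℝ) * (1 / 2) ^ S.card = 1 := by
    push_cast; rw [← mul_pow]; norm_num
  rw [this]
  simp
  norm_num

lemma quad_const {V : Type} [AddCommGroup V] [Module (ZMod 2) V] (c : ZMod 2) :
    IsQuad (fun _ : V => c) := by
  intro x a b; rfl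

lemma quad_add {V : Type} [AddCommGroup V] [Module (ZMod 2) V] {f g : V → ZMod 2}
    (hf : IsQuad f) (hg : IsQuad g) : IsQuad (fun x => f x + g x) := by
  intro x a b
  have h1 := hf x a b
  have h2 := hg x a b
  simp only
  linear_combination h1 + h2

lemma quad_sum {V ι : Type} [AddCommGroup V] [Module (ZMod 2) V] (T : Finset ι)
    (f : ι → V → ZMod 2) (hf : ∀ i ∈ T, IsQuad (f i)) : IsQuad (fun x => ∑ i ∈ T, f i x) := by
  classical
  induction T using Finset.induction_on with
  | empty => simpa using quad_const (V := V) 0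
  | insert i T hi ih =>
    simp only [Finset.sum_insert hi]
    exact quad_add (hf i (by simp)) (ih fun j hj => hf j (by simp [hj]))

lemma quad_mul {V : Type} [AddCommGroup V] [Module (ZMod 2) V] (f g : V →+ ZMod 2) :
    IsQuad (fun x => f x * g x) := by
  intro x a b
  simp only [map_add, map_zero]
  have h2 : (2 : ZMod 2) = 0 := by decide
  linear_combination (2 * f x * g x + f x * g b + f b * g x + f a * g x + f x * g a - f a * g a
    - f b * g b + f a * g a + f b * g b) * h2

lemma quad_lin {V : Type} [AddCommGroup V] [Module (ZMod 2) V] (f : V →+ ZMod 2) :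
    IsQuad (fun x => f x) := by
  intro x a b
  simp only [map_add, map_zero]
  have h2 : (2 : ZMod 2) = 0 := by decide
  linear_combination (2 * f x) * h2

lemma quad_deg {m : ℕ} (P : (Fin m → ZMod 2) → ZMod 2) (h : DegLE 2 P) : IsQuad P := by
  obtain ⟨p, hp, he⟩ := h
  have : P = fun x => ∑ d ∈ p.support, p.coeff d * ∏ i ∈ d.support, x i ^ d i := by
    funext x; rw [← he, MvPolynomial.eval_eq]
  rw [this]
  refine quad_sum _ _ fun d hd => ?_
  have hdeg : ∑ i ∈ d.support, d i ≤ 2 := (MvPolynomial.le_totalDegree hd).trans hp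
  rcases z2 (p.coeff d) with h | h
  · simpa [h] using quad_const (0 : ZMod 2)
  simp only [h, one_mul]
  have hpos : ∀ i ∈ d.support, 1 ≤ d i := fun i hi => Nat.one_le_iff_ne_zero.2 (Finsupp.mem_support_iff.1 hi)
  have hsq : ∀ a : ZMod 2, ∀ k, 1 ≤ k → a ^ k = a := by
    intro a k hk
    rcases z2 a with h | h
    · rw [h, zero_pow (by omega)]
    · rw [h, one_pow]
  have e : (fun x : Fin m → ZMod 2 => ∏ i ∈ d.support, x i ^ d i) =
      fun x => ∏ i ∈ d.support, x i := by
    funext x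
    exact Finset.prod_congr rfl fun i hi => hsq _ _ (hpos i hi)
  rw [e]
  have hc : d.support.card ≤ 2 := by
    refine le_trans ?_ hdeg
    rw [Finset.card_eq_sum_ones]
    exact Finset.sum_le_sum hpos
  generalize d.support = T at hc
  have hc' : T.card = 0 ∨ T.card = 1 ∨ T.card = 2 := by omega
  rcases hc' with h | h | h
  · rw [Finset.card_eq_zero.1 h]; simpa using quad_const (1 : ZMod 2)
  · obtain ⟨i, rfl⟩ := Finset.card_eq_one.1 h
    simpa using quad_lin (Pi.evalAddMonoidHom (fun _ : Fin m => ZMod 2) i)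
  · obtain ⟨i, j, hij, rfl⟩ := Finset.card_eq_two.1 h
    simp only [Finset.prod_pair hij]
    exact quad_mul (Pi.evalAddMonoidHom (fun _ : Fin m => ZMod 2) i)
      (Pi.evalAddMonoidHom (fun _ : Fin m => ZMod 2) j)

lemma nu_ber {n : ℕ} (y : Fin n → ZMod 2) : ber13 y = nu y := by
  unfold ber13 nu wt
  rw [Finset.prod_ite, Finset.prod_const, Finset.prod_const]
  congr 2
  have := Finset.card_filter_add_card_filter_not (s := (Finset.univ : Finset (Fin n))) (fun i => y i = 1)
  rw [Finset.card_univ, Fintype.card_fin] at this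
  omega

lemma tv_ov {m n : ℕ} (Q : Fin n → (Fin m → ZMod 2) → ZMod 2) :
    tvDist (outDist Q) ber13 = 1 - ov (fun x i => Q i x) := by
  have h1 := distOf_sum (fun (x : Fin m → ZMod 2) (i : Fin n) => Q i x)
  have h2 := nu_sum (ι := Fin n)
  have e : ∀ y : Fin n → ZMod 2, |outDist Q y - ber13 y| =
      distOf (fun x i => Q i x) y + nu y - 2 * min (distOf (fun x i => Q i x) y) (nu y) := by
    intro y
    rw [nu_ber]
    unfold outDist
    rcases le_total (distOf (fun (x : Fin m → ZMod 2) (i : Fin n) => Q i x) y) (nu y) with h | h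
    · rw [min_eq_left h, abs_of_nonpos (by linarith)]; ring
    · rw [min_eq_right h, abs_of_nonneg (by linarith)]; ring
  unfold tvDist ov
  simp only [e]
  rw [Finset.sum_sub_distrib, Finset.sum_add_distrib, ← Finset.mul_sum, h1, h2]
  ring

theorem step1 (C : ℕ) (hC : gam ^ C ≤ 1 / 2) (k : ℕ) (V ι : Type)
    [Fintype V] [AddCommGroup V] [Module (ZMod 2) V] [Fintype ι] [DecidableEq ι]
    (Q : ι → V → ZMod 2) (hQ : ∀ i, IsQuad (Q i))
    (hN : k + C * (2 * k) * (1 + C * (2 * k)) ^ (2 * k) ≤ Fintype.card ι) :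
    ov (fun x i => Q i x) ≤ 2 * gam ^ k := by
  classical
  let good : Finset ι → Prop := fun S => S.card ≤ k ∧ ∀ T ⊆ S, T.Nonempty →
    |bias (fun x => ∑ j ∈ T, Q j x)| ≤ (1 / 2) ^ k
  obtain ⟨S, hSm, hmax⟩ := Finset.exists_max_image
      (Finset.univ.filter fun S : Finset ι => good S) Finset.card
      ⟨∅, by
        simp only [Finset.mem_filter, Finset.mem_univ, true_and]
        refine ⟨by simp, fun T hT hn => ?_⟩
        rw [Finset.subset_empty.1 hT] at hn
        exact absurd hn Finset.not_nonempty_empty⟩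
  have hS : good S := by simpa using hSm
  obtain ⟨hSk, hSb⟩ := hS
  rcases hSk.eq_or_lt with hk | hk
  · rw [← hk]
    refine ov_subset Q S 2 (by norm_num) (fun _ _ => 1 / 2) (fun _ _ => by norm_num)
      (fun _ => by norm_num) (fun _ => by norm_num [abs_of_nonneg]) (fun y => ?_)
    have := fourier_bd Q S (by rw [hk]; exact hSb) y
    convert this
  -- each outside form is correlated
  have hT : ∀ i : {i // i ∉ S}, ∃ T ⊆ S,
      codim (InvS (fun x => Q i x + ∑ j ∈ T, Q j x)) ≤ 2 * k := by
    rintro ⟨i, hi⟩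
    have hng : ¬ good (insert i S) := by
      intro hg
      have h4 := hmax (insert i S) (by simpa using hg)
      rw [Finset.card_insert_of_notMem hi] at h4
      omega
    have : ∃ T ⊆ insert i S, T.Nonempty ∧ (1 / 2) ^ k < |bias (fun x => ∑ j ∈ T, Q j x)| := by
      by_contra hc
      push Not at hc
      exact hng ⟨by rw [Finset.card_insert_of_notMem hi]; omega, hc⟩
    obtain ⟨T, hTs, hTn, hTb⟩ := this
    have hiT : i ∈ T := by
      by_contra hc
      have : T ⊆ S := (Finset.subset_insert_iff_of_notMem hc).1 hTs
      exact absurd hTb (not_lt.2 (hSb T this hTn))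
    refine ⟨T.erase i, Finset.subset_insert_iff.1 hTs, ?_⟩
    have e : (fun x => Q i x + ∑ j ∈ T.erase i, Q j x) = fun x => ∑ j ∈ T, Q j x := by
      funext x
      exact Finset.add_sum_erase T (fun j => Q j x) hiT
    simp only [e]
    have hb : bias (fun x => ∑ j ∈ T, Q j x) ≠ 0 := by
      intro h0
      rw [h0, abs_zero] at hTb
      exact absurd hTb (not_lt.2 (by positivity))
    have h1 := (bias_sq' _ (quad_sum T Q fun i _ => hQ i)).resolve_left hb
    by_contra hc
    push Not at hc
    have h2 : ((1 / 2 : ℝ) ^ k) ^ 2 < bias (fun x => ∑ j ∈ T, Q j x) ^ 2 := by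
      rw [← sq_abs (bias _)]
      exact pow_lt_pow_left₀ hTb (by positivity) (by norm_num)
    have h3 : (2:ℝ) ^ (2 * k) ≤ 2 ^ codim (InvS (fun x => ∑ j ∈ T, Q j x)) :=
      pow_le_pow_right₀ (by norm_num) hc.le
    have h4 : ((1 / 2 : ℝ) ^ k) ^ 2 * 2 ^ (2 * k) = 1 := by
      rw [← pow_mul, mul_comm k 2, ← mul_pow]; norm_num
    have : (1:ℝ) < 1 := by
      calc (1:ℝ) = ((1 / 2 : ℝ) ^ k) ^ 2 * 2 ^ (2 * k) := h4.symm
        _ < bias (fun x => ∑ j ∈ T, Q j x) ^ 2 * 2 ^ (2 * k) :=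
          mul_lt_mul_of_pos_right h2 (by positivity)
        _ ≤ _ := mul_le_mul_of_nonneg_left h3 (sq_nonneg _)
        _ = 1 := h1
    exact lt_irrefl _ this
  choose T hTS hTc using hT
  refine (ov_marg (fun i => i ∉ S) (fun x i => Q i x)).trans ?_
  have h1 := ov_union (fun (x : V) (i : {i // i ∉ S}) => Q i x)
    (fun (b : {i // i ∈ S} → ZMod 2) (x : V) (i : {i // i ∉ S}) =>
      (Q i x + ∑ j ∈ T i, Q j x) + ∑ j : {i // i ∈ S}, if (j : ι) ∈ T i then b j else 0) ?_
  · refine h1.trans ?_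
    have h2 : ∀ b : {i // i ∈ S} → ZMod 2, ov (fun (x : V) (i : {i // i ∉ S}) =>
      (Q i x + ∑ j ∈ T i, Q j x) + ∑ j : {i // i ∈ S}, if (j : ι) ∈ T i then b j else 0) ≤
        (1 / 2) ^ (2 * k) := by
      intro b
      refine low_rank C hC (2 * k) (2 * k) le_rfl (2 * k) V {i // i ∉ S}
        (fun i x => (Q i x + ∑ j ∈ T i, Q j x) +
          ∑ j : {i // i ∈ S}, if (j : ι) ∈ T i then b j else 0) ?_ ?_ ?_
      · intro i
        exact quad_add (quad_add (hQ _) (quad_sum _ _ fun j _ => hQ j)) (quad_const _)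
      · intro i
        refine le_trans (codim_anti ?_) (hTc i)
        intro a ha x
        have := ha x
        simp only at this ⊢
        rw [this]
      · have hc : Fintype.card {i // i ∉ S} = Fintype.card ι - S.card := by
          rw [Fintype.card_subtype_compl, Fintype.card_coe]
        rw [hc]
        omega
    refine (Finset.sum_le_sum fun b _ => h2 b).trans ?_
    rw [Finset.sum_const, Finset.card_univ, nsmul_eq_mul, Fintype.card_fun, ZMod.card,
      Fintype.card_coe]
    push_cast
    calc (2:ℝ) ^ S.card * (1 / 2) ^ (2 * k) ≤ 2 ^ k * (1 / 2) ^ (2 * k) := by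
          gcongr; norm_num
      _ = (1 / 2) ^ k := by
        rw [two_mul, pow_add, ← mul_assoc, ← mul_pow]; norm_num
      _ ≤ gam ^ k := pow_le_pow_left₀ (by norm_num) (by unfold gam; norm_num) _
      _ ≤ 2 * gam ^ k := by linarith [pow_pos gam_pos k]
  · intro y
    simp only [distOf_eq]
    rw [← Finset.sum_div, Finset.sum_comm]
    gcongr with x
    set F : ({i // i ∈ S} → ZMod 2) → ℝ := fun b => if (fun (i : {i // i ∉ S}) =>
      (Q i x + ∑ j ∈ T i, Q j x) + ∑ j : {i // i ∈ S}, if (j : ι) ∈ T i then b j else 0) = y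
      then 1 else 0 with hF
    have hle : F (fun j => Q j x) ≤ ∑ b, F b :=
      Finset.single_le_sum (f := F) (fun b _ => by simp only [hF]; split_ifs <;> norm_num)
        (Finset.mem_univ _)
    refine le_trans (le_of_eq ?_) hle
    have e : (fun (i : {i // i ∉ S}) =>
      (Q i x + ∑ j ∈ T i, Q j x) + ∑ j : {i // i ∈ S}, if (j : ι) ∈ T i then Q j x else 0) =
        fun i : {i // i ∉ S} => Q i x := by
      funext i
      have : (∑ j : {i // i ∈ S}, if (j : ι) ∈ T i then Q j x else 0) = ∑ j ∈ T i, Q j x := by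
        rw [Finset.sum_coe_sort S (fun j => if j ∈ T i then Q j x else 0), ← Finset.sum_filter]
        congr 1
        ext j
        simp only [Finset.mem_filter]
        exact ⟨fun h => h.2, fun h => ⟨hTS i h, h⟩⟩
      rw [this, add_assoc, z2_self, add_zero]
    simp only [hF, e]

lemma log_small (M : ℝ) (hM : 0 < M) : ∀ᶠ x : ℝ in Filter.atTop, M * Real.log x ≤ x := by
  have h := Real.isLittleO_log_id_atTop.def (inv_pos.2 hM)
  filter_upwards [h, Filter.eventually_ge_atTop 1] with x hx h1
  rw [Real.norm_of_nonneg (Real.log_nonneg h1), id, Real.norm_of_nonneg (by linarith)] at hx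
  rw [inv_mul_eq_div, le_div_iff₀ hM] at hx
  linarith

lemma nat_bound (C k : ℕ) (hC : 1 ≤ C) :
    k + C * (2 * k) * (1 + C * (2 * k)) ^ (2 * k) ≤ (1 + C * (2 * k)) ^ (2 * k + 1) := by
  rcases Nat.eq_zero_or_pos k with h | h
  · subst h; simp
  · have h1 : (1 + C * (2 * k)) ^ 1 ≤ (1 + C * (2 * k)) ^ (2 * k) :=
      Nat.pow_le_pow_right (by omega) (by omega)
    have h2 : k ≤ C * (2 * k) := by nlinarith
    rw [pow_succ]
    rw [pow_one] at h1
    nlinarith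

lemma asym (C : ℕ) (hC : 1 ≤ C) : ∃ c > (0:ℝ), ∀ᶠ n : ℕ in Filter.atTop, ∃ k : ℕ,
    k + C * (2 * k) * (1 + C * (2 * k)) ^ (2 * k) ≤ n ∧
    2 * gam ^ k ≤ (n:ℝ) ^ (-(c / Real.logb 2 (Real.logb 2 (n:ℝ)))) := by
  set δ := - Real.log gam with hδ
  have hδ0 : 0 < δ := by
    have := Real.log_neg gam_pos gam_lt
    linarith
  refine ⟨δ / 16, by positivity, ?_⟩
  have hl2 : 0 < Real.log 2 := Real.log_pos (by norm_num)
  have hl2' : Real.log 2 < 1 := by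
    have := Real.log_two_lt_d9; linarith
  have hM : 0 < 16 * (Real.log 2 + δ) / δ := by positivity
  have hL : Filter.Tendsto (fun n : ℕ => Real.log (n:ℝ)) Filter.atTop Filter.atTop :=
    Real.tendsto_log_atTop.comp tendsto_natCast_atTop_atTop
  have hl : Filter.Tendsto (fun n : ℕ => Real.log (Real.log (n:ℝ))) Filter.atTop Filter.atTop :=
    Real.tendsto_log_atTop.comp hL
  filter_upwards [Filter.eventually_ge_atTop 1, hL.eventually_ge_atTop ((C:ℝ) + 1),
    hl.eventually_ge_atTop 1, hL.eventually (log_small 4 (by norm_num)),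
    hL.eventually (log_small _ hM)] with n hn1 hLC hl1 h4 hMl
  set L := Real.log (n:ℝ) with hLdef
  set l := Real.log L with hldef
  have hC' : (1:ℝ) ≤ C := by exact_mod_cast hC
  have hLpos : 0 < L := by linarith
  have hlpos : 0 < l := by linarith
  have hnpos : (0:ℝ) < n := by exact_mod_cast hn1
  have hu0 : 0 ≤ L / (8 * l) := by positivity
  set k := ⌊L / (8 * l)⌋₊ with hk
  have hku : (k:ℝ) ≤ L / (8 * l) := Nat.floor_le hu0
  have huk : L / (8 * l) < k + 1 := Nat.lt_floor_add_one _
  have hkl : (k:ℝ) * (8 * l) ≤ L := by rwa [le_div_iff₀ (by positivity)] at hku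
  have hk0 : (0:ℝ) ≤ k := Nat.cast_nonneg k
  refine ⟨k, ?_, ?_⟩
  · refine (nat_bound C k hC).trans ?_
    have : (((1 + C * (2 * k)) ^ (2 * k + 1) : ℕ) : ℝ) ≤ n := by
      push_cast
      have hk8 : 8 * (k:ℝ) ≤ L := by nlinarith
      have hb : 1 + (C:ℝ) * (2 * k) ≤ L ^ 2 := by nlinarith
      calc (1 + (C:ℝ) * (2 * k)) ^ (2 * k + 1) ≤ (L ^ 2) ^ (2 * k + 1) :=
            pow_le_pow_left₀ (by positivity) hb _
        _ = Real.exp (l * (4 * k + 2)) := by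
          rw [← pow_mul, ← Real.rpow_natCast, Real.rpow_def_of_pos hLpos]
          congr 1
          push_cast; ring
        _ ≤ Real.exp L := Real.exp_le_exp.2 (by nlinarith)
        _ = n := Real.exp_log hnpos
    exact_mod_cast this
  · have e1 : 2 * gam ^ k = Real.exp (Real.log 2 - δ * k) := by
      rw [Real.exp_sub, Real.exp_log (by norm_num), hδ, neg_mul, Real.exp_neg, div_inv_eq_mul,
        mul_comm (Real.log gam), ← Real.log_pow, Real.exp_log (pow_pos gam_pos _)]
    rw [e1, Real.rpow_def_of_pos hnpos]
    refine Real.exp_le_exp.2 ?_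
    rw [← hLdef]
    have hlog : l ≤ Real.logb 2 (Real.logb 2 (n:ℝ)) := by
      have a1 : L ≤ Real.logb 2 (n:ℝ) := by
        rw [Real.logb, le_div_iff₀ hl2]; nlinarith
      have a2 : l ≤ Real.log (Real.logb 2 (n:ℝ)) := Real.log_le_log hLpos a1
      rw [Real.logb, le_div_iff₀ hl2]
      nlinarith
    have he : δ / 16 / Real.logb 2 (Real.logb 2 (n:ℝ)) ≤ δ / 16 / l :=
      div_le_div_of_nonneg_left (by positivity) hlpos hlog
    have h5 : L * (δ / 16 / Real.logb 2 (Real.logb 2 (n:ℝ))) ≤ L * (δ / 16 / l) :=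
      mul_le_mul_of_nonneg_left he hLpos.le
    have h6 : L * (δ / 16 / l) = δ / 2 * (L / (8 * l)) := by field_simp; ring
    have h7 : 2 * (Real.log 2 + δ) / δ ≤ L / (8 * l) := by
      rw [le_div_iff₀ (by positivity)]
      calc 2 * (Real.log 2 + δ) / δ * (8 * l) = 16 * (Real.log 2 + δ) / δ * l := by ring
        _ ≤ L := hMl
    rw [div_le_iff₀ hδ0] at h7
    nlinarith

end

/-- quadratic distributions are `1 - n^{-c/log₂ log₂ n}`-far
from `Ber(1/3)^{⊗n}` for large enough `n`. -/
theorem quadratic_lower_bound :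
    ∃ c > (0:ℝ), ∃ n₀ : ℕ, ∀ n : ℕ, n₀ ≤ n → ∀ m : ℕ,
      ∀ Q : Fin n → (Fin m → ZMod 2) → ZMod 2, (∀ i, DegLE 2 (Q i)) →
        tvDist (outDist Q) ber13 ≥
          1 - (n:ℝ) ^ (-(c / Real.logb 2 (Real.logb 2 (n:ℝ)))) := by
  obtain ⟨C, hC⟩ := exists_pow_lt_of_lt_one (show (0:ℝ) < 1 / 2 by norm_num) gam_lt
  have hC1 : 1 ≤ C := by
    rcases Nat.eq_zero_or_pos C with h | h
    · subst h; norm_num at hC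
    · exact h
  obtain ⟨c, hc, h⟩ := asym C hC1
  obtain ⟨n₀, hn₀⟩ := Filter.eventually_atTop.1 h
  refine ⟨c, hc, n₀, fun n hn m Q hQ => ?_⟩
  obtain ⟨k, hk, hg⟩ := hn₀ n hn
  have := step1 C hC.le k (Fin m → ZMod 2) (Fin n) Q (fun i => quad_deg _ (hQ i))
    (by rw [Fintype.card_fin]; exact hk)
  rw [tv_ov]
  linarith
end
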